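/- Let k ≥ 3, 1 ≤ a ≤ k−1, m ≥ 1 and λ = mω_a. Let V^λ be an irreducible highest weight U_q(sl_k)-module with highest weight vector v_λ, Shapovalov form (·,·), crystal basis B^λ, lower global basis G^λ = {G_b}, and upper global basis F^λ = {F_b}_{b ∈ B^λ} (the dual basis of G^λ with respect to the Shapovalov form). For 0 ≤ j ≤ m set v_j := f_{k−1}^{(j)} ⋯ f_a^{(j)} v_λ; let V̂^{λ^j} be an irreducible highest weight U_q(sl_{k−1})-module with highest weight λ^j := j ω′_{a−1} + (m−j) ω′_a and highest weight vector u_j, with crystal basis B̂^{λ^j}, lower global basis Ĝ^{λ^j}, Shapovalov form (·,·)_j, and upper global basis F̂^{λ^j} = {F̂^j_b}; let φ_j : V̂^{λ^j} → U_q(sl_{k−1})v_j ⊆ V^λ be the U_q(sl_{k−1})-module isomorphism with φ_j(u_j) = v_j. Then F^λ = ⊔_{j=0}^m φ_j(F̂^{λ^j})/(v_j, v_j); in particular, φ_j(F̂^j_b)/(v_j, v_j) = F_{φ_j(b)} for all b ∈ B̂^{λ^j}. -/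

import Mathlib

/-!
Common setup: the quantum group `U_q(sl_k)` (presented by generators
`e_i, f_i, K_i = q^{h_i}, K_i⁻¹` for `1 ≤ i ≤ k-1` and the standard relations)
over the field `KK = ℚ(q)`, and the notion of an irreducible highest weight
module.  Weights are recorded as functions `μ : ℕ → ℤ`, `μ i` being the value
`μ(h_i)` on the `i`-th simple coroot.
-/

noncomputable section
namespace QSL

abbrev KK : Type := RatFunc ℚ

/-- the variable `q`. -/
def qv : KK := RatFunc.X

/-- the quantum integer `[n]_q = (qⁿ - q⁻ⁿ)/(q - q⁻¹)`. -/
def qInt (n : ℕ) : KK := (qv ^ n - qv⁻¹ ^ n) / (qv - qv⁻¹)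

/-- the quantum factorial `[n]_q!`. -/
def qFact : ℕ → KK
  | 0 => 1
  | n + 1 => qFact n * qInt (n + 1)

/-- the Gaussian binomial coefficient `[m choose j]_q`. -/
def qBinom (m j : ℕ) : KK :=
  (∏ t ∈ Finset.range j, qInt (m - t)) / (∏ t ∈ Finset.range j, qInt (j - t))

/-- the Cartan matrix of `sl`:  `cartan i j = αⱼ(h_i)`. -/
def cartan (i j : ℕ) : ℤ := if i = j then 2 else if i + 1 = j ∨ j + 1 = i then -1 else 0

/-- The quantum group with `d` nodes (`d = k - 1` for `U_q(sl_k)`): a unital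
associative `ℚ(q)`-algebra generated by elements `e i, f i, K i, Kinv i`
(`1 ≤ i ≤ d`, where `K i = q^{h_i}`) subject to the standard relations. -/
structure QGroup (d : ℕ) where
  U : Type
  [ring : Ring U]
  [alg : Algebra KK U]
  e : ℕ → U
  f : ℕ → U
  K : ℕ → U
  Kinv : ℕ → U
  K_mul_Kinv : ∀ i, 1 ≤ i → i ≤ d → K i * Kinv i = 1
  Kinv_mul_K : ∀ i, 1 ≤ i → i ≤ d → Kinv i * K i = 1
  K_comm : ∀ i j, 1 ≤ i → i ≤ d → 1 ≤ j → j ≤ d → K i * K j = K j * K i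
  K_e_Kinv : ∀ i j, 1 ≤ i → i ≤ d → 1 ≤ j → j ≤ d →
      K i * e j * Kinv i = (qv ^ cartan i j) • e j
  K_f_Kinv : ∀ i j, 1 ≤ i → i ≤ d → 1 ≤ j → j ≤ d →
      K i * f j * Kinv i = (qv ^ (-cartan i j)) • f j
  e_f_comm : ∀ i j, 1 ≤ i → i ≤ d → 1 ≤ j → j ≤ d →
      e i * f j - f j * e i = if i = j then (qv - qv⁻¹)⁻¹ • (K i - Kinv i) else 0
  serre_e : ∀ i j, 1 ≤ i → i ≤ d → 1 ≤ j → j ≤ d → (i + 1 = j ∨ j + 1 = i) →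
      e i * e i * e j - (qv + qv⁻¹) • (e i * e j * e i) + e j * e i * e i = 0
  serre_f : ∀ i j, 1 ≤ i → i ≤ d → 1 ≤ j → j ≤ d → (i + 1 = j ∨ j + 1 = i) →
      f i * f i * f j - (qv + qv⁻¹) • (f i * f j * f i) + f j * f i * f i = 0
  comm_e : ∀ i j, 1 ≤ i → i ≤ d → 1 ≤ j → j ≤ d → (i + 1 < j ∨ j + 1 < i) →
      e i * e j = e j * e i
  comm_f : ∀ i j, 1 ≤ i → i ≤ d → 1 ≤ j → j ≤ d → (i + 1 < j ∨ j + 1 < i) →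
      f i * f j = f j * f i
  gen : ∀ x : U, x ∈ Algebra.adjoin KK
      {y : U | ∃ i, 1 ≤ i ∧ i ≤ d ∧ (y = e i ∨ y = f i ∨ y = K i ∨ y = Kinv i)}

attribute [instance] QGroup.ring QGroup.alg

variable {d : ℕ} (G : QGroup d)

/-- the divided power `f_i^{(n)} = f_iⁿ/[n]_q!`. -/
def fDiv (i n : ℕ) : G.U := (qFact n)⁻¹ • (G.f i) ^ n

/-- the divided power `e_i^{(n)} = e_iⁿ/[n]_q!`. -/
def eDiv (i n : ℕ) : G.U := (qFact n)⁻¹ • (G.e i) ^ n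

variable {V : Type} [AddCommGroup V] [Module KK V] [Module G.U V] [IsScalarTower KK G.U V]

/-- `u` is a weight vector of weight `μ` (recorded via `μ i = μ(h_i)`). -/
def IsWtVec (u : V) (μ : ℕ → ℤ) : Prop :=
  ∀ i, 1 ≤ i → i ≤ d → G.K i • u = (qv ^ μ i) • u

/-- `V` is an irreducible highest weight module over `G` with highest weight
`lam` and highest weight vector `v`: it is finite dimensional over `ℚ(q)`,
has a weight space decomposition, `v` is a nonzero weight vector of weight
`lam` annihilated by the `e_i`, `V` is generated by `v`, and `V` is
irreducible. -/
structure IsHWModule (lam : ℕ → ℤ) (v : V) : Prop where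
  findim : FiniteDimensional KK V
  ne_zero : v ≠ 0
  wt : IsWtVec G v lam
  hw : ∀ i, 1 ≤ i → i ≤ d → G.e i • v = 0
  gen : ∀ w : V, ∃ p : G.U, p • v = w
  irred : ∀ W : Submodule G.U V, W = ⊥ ∨ W = ⊤
  decomp : Submodule.span KK {u : V | ∃ μ : ℕ → ℤ, IsWtVec G u μ} = ⊤

/-- the weight `m ω_a`. -/
def omWt (a m : ℕ) : ℕ → ℤ := fun i => if i = a then (m : ℤ) else 0

/-- the weight `j ω_{a-1} + (m - j) ω_a`. -/
def hookWt (a m j : ℕ) : ℕ → ℤ := fun i =>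
  (if i = a - 1 then (j : ℤ) else 0) + (if i = a then (m : ℤ) - (j : ℤ) else 0)

/-- `f_{a'}^{(c_{a'})} ⋯ f_{a+1}^{(c_{a+1})} f_a^{(c_a)} • v`. -/
def fDivChain (c : ℕ → ℕ) (a a' : ℕ) (v : V) : V :=
  (List.range (a' + 1 - a)).foldl (fun u r => fDiv G (a + r) (c (a + r)) • u) v

/-- An `i`-string decomposition of the weight vector `u`: a triple
`p = (N, u_·, μ)` where `u` has weight `μ`, each `u_n` lies in `ker e_i`, is a
weight vector of weight `μ + n αᵢ`, and `u = ∑_{n=0}^{N} f_i^{(n)} • u_n`. -/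
def KashDecomp (i : ℕ) (u : V) (p : ℕ × (ℕ → V) × (ℕ → ℤ)) : Prop :=
  IsWtVec G u p.2.2 ∧
  (∀ n, n ≤ p.1 → G.e i • p.2.1 n = 0 ∧
      IsWtVec G (p.2.1 n) fun t => p.2.2 t + n * cartan i t) ∧
  u = ∑ n ∈ Finset.range (p.1 + 1), fDiv G i n • p.2.1 n

open Classical in
/-- The Kashiwara lowering operator `f̃ᵢ`: on a weight vector with string
decomposition `u = ∑ f_i^{(n)} u_n` it returns `∑ f_i^{(n+1)} u_n`. -/
noncomputable def kashF (i : ℕ) (u : V) : V :=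
  if h : ∃ p : ℕ × (ℕ → V) × (ℕ → ℤ), KashDecomp G i u p then
    ∑ n ∈ Finset.range (h.choose.1 + 1), fDiv G i (n + 1) • h.choose.2.1 n
  else 0

/-- `f̃_{i_r} ⋯ f̃_{i_1} u` for `is = [i_1, …, i_r]`. -/
noncomputable def kashSeq (is : List ℕ) (u : V) : V :=
  is.foldl (fun w i => kashF G i w) u

private lemma eval_ne_zero_of_dvd {a b : Polynomial ℚ} (h : a ∣ b) (hb : b.eval 0 ≠ 0) :
    a.eval 0 ≠ 0 := by
  obtain ⟨c, rfl⟩ := h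
  simp only [Polynomial.eval_mul, ne_eq, mul_eq_zero, not_or] at hb
  exact hb.1

/-- `A₀`: the subring of `ℚ(q)` of rational functions regular at `q = 0`,
i.e. the localization of `ℚ[q]` at the prime ideal `(q)`. -/
def A0 : Subring KK where
  carrier := {x : KK | (RatFunc.denom x).eval 0 ≠ 0}
  one_mem' := by simp [RatFunc.denom_one]
  zero_mem' := by simp [RatFunc.denom_zero]
  mul_mem' := by
    intro x y hx hy
    refine eval_ne_zero_of_dvd (RatFunc.denom_mul_dvd x y) ?_
    simpa [Polynomial.eval_mul] using mul_ne_zero hx hy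
  add_mem' := by
    intro x y hx hy
    refine eval_ne_zero_of_dvd (RatFunc.denom_add_dvd x y) ?_
    simpa [Polynomial.eval_mul] using mul_ne_zero hx hy
  neg_mem' := by
    intro x hx
    have hneg : (-x) = (-1 : KK) * x := by ring
    rw [hneg]
    refine eval_ne_zero_of_dvd (RatFunc.denom_mul_dvd (-1) x) ?_
    have h1 : (RatFunc.denom (-1 : KK)) = 1 := by
      have : (-1 : KK) = algebraMap (Polynomial ℚ) KK (-1) := by simp
      rw [this, RatFunc.denom_algebraMap]
    simpa [Polynomial.eval_mul, h1] using hx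

/-- Multiplication by `q` as an `A₀`-linear endomorphism. -/
def qSmulMap : V →ₗ[↥A0] V where
  toFun x := qv • x
  map_add' x y := smul_add qv x y
  map_smul' c x := by
    show qv • ((c : KK) • x) = ((c : KK) • qv • x : V)
    rw [smul_smul, smul_smul, mul_comm]

/-- a `ℚ(q)`-linear map, viewed as an `A₀`-linear map. -/
def toA0Linear {W : Type} [AddCommGroup W] [Module KK W] (f : V →ₗ[KK] W) : V →ₗ[↥A0] W where
  toFun := f
  map_add' := f.map_add
  map_smul' c x := by
    show f ((c : KK) • x) = (c : KK) • f x
    rw [map_smul]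

/-- the vectors `f̃_{i_r} ⋯ f̃_{i_1} v`. -/
noncomputable def latticeGens (v : V) : Set V :=
  {u | ∃ is : List ℕ, (∀ i ∈ is, 1 ≤ i ∧ i ≤ d) ∧ u = kashSeq G is v}

/-- the crystal lattice `L`: the `A₀`-span of the `f̃_{i_r} ⋯ f̃_{i_1} v`. -/
noncomputable def Llat (v : V) : Submodule ↥A0 V :=
  Submodule.span ↥A0 (latticeGens G v)

/-- the `A₀`-submodule `qL ⊆ L`. -/
noncomputable def qLmod (v : V) : Submodule ↥A0 V :=
  Submodule.map qSmulMap (Llat G v)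

/-- the generators `e_i, f_i, K_i, K_i⁻¹` with `1 ≤ i ≤ b`. -/
def subGens (b : ℕ) : Set G.U :=
  {y | ∃ i, 1 ≤ i ∧ i ≤ b ∧ (y = G.e i ∨ y = G.f i ∨ y = G.K i ∨ y = G.Kinv i)}

/-- the subalgebra `U_q(sl_{b+1}) ⊆ U_q(sl_{d+1})` generated by
`e_i, f_i, q^{±h_i}` for `1 ≤ i ≤ b`. -/
def Usub (b : ℕ) : Subalgebra KK G.U := Algebra.adjoin KK (subGens G b)

/-- the subspace `U_q(sl_{b+1}) • x ⊆ V`. -/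
def USpan (b : ℕ) (x : V) : Submodule KK V :=
  Submodule.span KK {w : V | ∃ p ∈ Usub G b, w = p • x}

/-- `B` is the Shapovalov form on `V` with respect to the highest weight
vector `v`: the symmetric bilinear form with `B v v = 1` which is
contravariant with respect to the antiautomorphism `φ` interchanging
`e_i ↔ f_i` and fixing `q^h`. -/
def IsShapovalov (v : V) (B : V →ₗ[KK] V →ₗ[KK] KK) : Prop :=
  (∀ x y, B x y = B y x) ∧ B v v = 1 ∧
  (∀ i, 1 ≤ i → i ≤ d → ∀ x y, B (G.e i • x) y = B x (G.f i • y)) ∧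
  (∀ i, 1 ≤ i → i ≤ d → ∀ x y, B (G.f i • x) y = B x (G.e i • y)) ∧
  (∀ i, 1 ≤ i → i ≤ d → ∀ x y, B (G.K i • x) y = B x (G.K i • y)) ∧
  (∀ i, 1 ≤ i → i ≤ d → ∀ x y, B (G.Kinv i • x) y = B x (G.Kinv i • y))

/-- the subring `A = ℚ[q, q⁻¹] ⊆ ℚ(q)`. -/
def Asub : Subring KK := Subring.closure ({qv, qv⁻¹} ∪ Set.range (algebraMap ℚ KK))

/-- `q^{z h_i}` as an element of `G.U`. -/
def zKpow (i : ℕ) (z : ℤ) : G.U := if 0 ≤ z then G.K i ^ z.toNat else G.Kinv i ^ (-z).toNat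

/-- `q^h` for `h = ∑ c_i h_i` in the coroot lattice. -/
def KmonZ (c : ℕ → ℤ) : G.U := ((List.range d).map fun t => zKpow G (t + 1) (c (t + 1))).prod

/-- the element `[q^h; s]_q = (q^h q^s - q^{-h} q^{-s})/(q - q⁻¹)`. -/
def qhBr (c : ℕ → ℤ) (s : ℤ) : G.U :=
  (qv - qv⁻¹)⁻¹ • ((qv ^ s) • KmonZ G c - (qv ^ (-s)) • KmonZ G (fun t => -c t))

/-- the element `[q^h; 0]_q [q^h; -1]_q ⋯ [q^h; 1-n]_q / [n]_q!`. -/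
def qhDiv (c : ℕ → ℤ) (n : ℕ) : G.U :=
  (qFact n)⁻¹ • ((List.range n).map fun s => qhBr G c (-(s : ℤ))).prod

/-- the `A`-subalgebra `U_A ⊆ U_q` generated by the divided powers
`e_i^{(n)}, f_i^{(n)}`, the `q^h`, and the `[q^h; 0]_q ⋯ [q^h; 1-n]_q/[n]_q!`. -/
def UAring : Subring G.U :=
  Subring.closure
    ({x | ∃ y ∈ Asub, x = algebraMap KK G.U y} ∪
     {x | ∃ i n, 1 ≤ i ∧ i ≤ d ∧ (x = eDiv G i n ∨ x = fDiv G i n)} ∪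
     {x | ∃ c : ℕ → ℤ, x = KmonZ G c ∨ ∃ n, x = qhDiv G c n})

/-- the subset `U_A • v ⊆ V`. -/
def UAv (v : V) : Set V := {x : V | ∃ p ∈ UAring G, x = p • v}

/-- `barK` is the `ℚ`-algebra automorphism of `ℚ(q)` with `q ↦ q⁻¹`. -/
def IsBarK (barK : KK →+* KK) : Prop :=
  barK qv = qv⁻¹ ∧ ∀ r : ℚ, barK (algebraMap ℚ KK r) = algebraMap ℚ KK r

/-- `psi` is the `ψ`-involution of `(V, v)`: the `barK`-semilinear additive
involution with `ψ(v) = v`, `ψ(e_i x) = e_i ψ(x)`, `ψ(f_i x) = f_i ψ(x)` and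
`ψ(q^h x) = q^{-h} ψ(x)`.  (These properties determine it uniquely.) -/
def IsPsi (v : V) (barK : KK →+* KK) (psi : V →+ V) : Prop :=
  psi v = v ∧
  (∀ (c : KK) (x : V), psi (c • x) = barK c • psi x) ∧
  (∀ i, 1 ≤ i → i ≤ d → ∀ x : V, psi (G.e i • x) = G.e i • psi x) ∧
  (∀ i, 1 ≤ i → i ≤ d → ∀ x : V, psi (G.f i • x) = G.f i • psi x) ∧
  (∀ i, 1 ≤ i → i ≤ d → ∀ x : V, psi (G.K i • x) = G.Kinv i • psi x) ∧
  (∀ i, 1 ≤ i → i ≤ d → ∀ x : V, psi (G.Kinv i • x) = G.K i • psi x)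

variable [Module ℚ V] [IsScalarTower ℚ KK V]

/-- `Gs` is the lower global basis of `(V, v)`: the unique `A₀`-basis of the
crystal lattice `L` which is a `ℚ`-basis of `U_A v ∩ L ∩ ψ(L)`, is fixed by
`ψ`, and reduces modulo `qL` bijectively onto the crystal basis `B`. -/
noncomputable def IsLowerGlobalBasis (v : V) (psi : V →+ V) (Gs : Set V) : Prop :=
  Submodule.span ↥A0 Gs = Llat G v ∧
  LinearIndependent ↥A0 (fun g : Gs => (g : V)) ∧
  Gs ⊆ UAv G v ∩ (Llat G v : Set V) ∩ (psi '' (Llat G v : Set V)) ∧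
  LinearIndependent ℚ (fun g : Gs => (g : V)) ∧
  (∀ x, x ∈ UAv G v ∩ (Llat G v : Set V) ∩ (psi '' (Llat G v : Set V)) →
    x ∈ Submodule.span ℚ Gs) ∧
  (∀ g ∈ Gs, psi g = g) ∧
  (∀ g ∈ Gs, ∃ u ∈ latticeGens G v, u ∉ qLmod G v ∧ g - u ∈ qLmod G v) ∧
  (∀ g ∈ Gs, ∀ g' ∈ Gs, g - g' ∈ qLmod G v → g = g') ∧
  (∀ u ∈ latticeGens G v, u ∉ qLmod G v → ∃ g ∈ Gs, g - u ∈ qLmod G v)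

open Classical

set_option linter.unusedSectionVars false

theorem qv_zpow_ne_one {z : ℤ} (hz : z ≠ 0) : qv ^ z ≠ 1 := by
  have key : ∀ n : ℕ, 0 < n → qv ^ n ≠ 1 := by
    intro n hn h
    have h1 : algebraMap (Polynomial ℚ) KK (Polynomial.X ^ n) =
        algebraMap (Polynomial ℚ) KK 1 := by
      rw [map_pow, RatFunc.algebraMap_X, map_one]
      exact h
    have h2 := RatFunc.algebraMap_injective ℚ h1
    have h3 := congrArg Polynomial.natDegree h2
    simp at h3
    omega
  obtain ⟨n, rfl | rfl⟩ := z.eq_nat_or_neg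
  · rw [zpow_natCast]
    exact key n (by omega)
  · rw [zpow_neg, zpow_natCast, ne_eq, inv_eq_one]
    exact key n (by omega)

theorem qv_ne_zero : qv ≠ 0 := RatFunc.X_ne_zero

theorem qv_zpow_injective {s t : ℤ} (h : qv ^ s = qv ^ t) : s = t := by
  by_contra hne
  refine qv_zpow_ne_one (sub_ne_zero.mpr hne) ?_
  rw [zpow_sub₀ qv_ne_zero, h, div_self (zpow_ne_zero _ qv_ne_zero)]

theorem qv_sub_inv_ne_zero : qv - qv⁻¹ ≠ 0 := by
  intro h
  have : qv ^ (1 : ℤ) = qv ^ (-1 : ℤ) := by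
    rw [zpow_one, zpow_neg, zpow_one]
    exact sub_eq_zero.mp h
  exact absurd (qv_zpow_injective this) (by norm_num)

/-- the quantum integer `[z]_q` for an integer `z`. -/
def qIntZ (z : ℤ) : KK := (qv ^ z - qv ^ (-z)) / (qv - qv⁻¹)

theorem qInt_eq (n : ℕ) : qInt n = qIntZ n := by
  simp [qInt, qIntZ]

theorem qIntZ_zero : qIntZ 0 = 0 := by simp [qIntZ]

theorem qIntZ_one : qIntZ 1 = 1 := by
  simp [qIntZ, div_self qv_sub_inv_ne_zero]

theorem qIntZ_ne_zero {z : ℤ} (hz : z ≠ 0) : qIntZ z ≠ 0 := by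
  refine div_ne_zero (fun h => ?_) qv_sub_inv_ne_zero
  have := qv_zpow_injective (sub_eq_zero.mp h)
  omega

theorem qInt_succ_ne_zero (n : ℕ) : qInt (n + 1) ≠ 0 := by
  rw [qInt_eq]
  exact qIntZ_ne_zero (by push_cast; omega)

theorem qFact_ne_zero (n : ℕ) : qFact n ≠ 0 := by
  induction n with
  | zero => exact one_ne_zero
  | succ n ih => exact mul_ne_zero ih (qInt_succ_ne_zero n)

/-- `[n+1][s-n] = [n][s-n+1] + [s-2n]`. -/
theorem qIntZ_string (n s : ℤ) :
    qIntZ (n + 1) * qIntZ (s - n) = qIntZ n * qIntZ (s - n + 1) + qIntZ (s - 2 * n) := by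
  have h0 := qv_ne_zero
  have h1 := qv_sub_inv_ne_zero
  have e1 : (-(n + 1) : ℤ) = -n + -1 := by ring
  have e2 : (-(s - n) : ℤ) = -s + n := by ring
  have e3 : (-(s - n + 1) : ℤ) = -s + n + -1 := by ring
  have e4 : (s - 2 * n : ℤ) = s + -n + -n := by ring
  have e5 : (-(s + -n + -n) : ℤ) = -s + n + n := by ring
  have e6 : (s - n : ℤ) = s + -n := by ring
  unfold qIntZ
  rw [e1, e2, e3, e4, e5, e6]
  simp only [zpow_add₀ h0, zpow_neg, zpow_one]
  have hs : qv ^ s ≠ 0 := zpow_ne_zero _ h0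
  have hn : qv ^ n ≠ 0 := zpow_ne_zero _ h0
  field_simp
  ring

/-- `[n+1][s+n] = [n][s+n-1] + [s+2n]`. -/
theorem qIntZ_string' (n s : ℤ) :
    qIntZ (n + 1) * qIntZ (s + n) = qIntZ n * qIntZ (s + n - 1) + qIntZ (s + 2 * n) := by
  have h0 := qv_ne_zero
  have h1 := qv_sub_inv_ne_zero
  have e1 : (-(n + 1) : ℤ) = -n + -1 := by ring
  have e2 : (-(s + n) : ℤ) = -s + -n := by ring
  have e3 : (-(s + n + -1) : ℤ) = -s + -n + 1 := by ring
  have e4 : (s + 2 * n : ℤ) = s + n + n := by ring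
  have e5 : (-(s + n + n) : ℤ) = -s + -n + -n := by ring
  have e6 : (s + n - 1 : ℤ) = s + n + -1 := by ring
  unfold qIntZ
  rw [e1, e2, e6, e3, e4, e5]
  simp only [zpow_add₀ h0, zpow_neg, zpow_one]
  have hs : qv ^ s ≠ 0 := zpow_ne_zero _ h0
  have hn : qv ^ n ≠ 0 := zpow_ne_zero _ h0
  field_simp
  ring

variable {G} in
theorem e_f_smul_of_ne {M : Type} [AddCommGroup M] [Module G.U M] {i j : ℕ} (h1 : 1 ≤ i)
    (h2 : i ≤ d) (h3 : 1 ≤ j) (h4 : j ≤ d) (hij : i ≠ j) (x : M) :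
    G.e i • G.f j • x = G.f j • G.e i • x := by
  have h := G.e_f_comm i j h1 h2 h3 h4
  rw [if_neg hij, sub_eq_zero] at h
  rw [smul_smul, h, mul_smul]

section Rank

variable {M : Type} [AddCommGroup M] [Module KK M] [Module G.U M] [IsScalarTower KK G.U M]

variable {G} in
theorem Kinv_smul_of_K_smul {i : ℕ} (h1 : 1 ≤ i) (h2 : i ≤ d) {s : ℤ} {x : M}
    (hx : G.K i • x = qv ^ s • x) : G.Kinv i • x = qv ^ (-s) • x := by
  have h : G.Kinv i • G.K i • x = x := by rw [smul_smul, G.Kinv_mul_K i h1 h2, one_smul]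
  rw [hx, smul_comm] at h
  rw [zpow_neg, ← h, smul_smul, inv_mul_cancel₀ (zpow_ne_zero _ qv_ne_zero), one_smul, h]

variable {G} in
theorem K_smul_e_smul {i j : ℕ} (h1 : 1 ≤ i) (h2 : i ≤ d) (h3 : 1 ≤ j) (h4 : j ≤ d) {s : ℤ} {x : M}
    (hx : G.K i • x = qv ^ s • x) : G.K i • G.e j • x = qv ^ (s + cartan i j) • G.e j • x := by
  have h : G.K i * G.e j = (qv ^ cartan i j) • (G.e j * G.K i) := by
    rw [← smul_mul_assoc, ← G.K_e_Kinv i j h1 h2 h3 h4, mul_assoc, G.Kinv_mul_K i h1 h2, mul_one]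
  rw [smul_smul, h, smul_assoc, mul_smul, hx, smul_comm (G.e j), smul_smul, add_comm,
    zpow_add₀ qv_ne_zero]

variable {G} in
theorem K_smul_f_smul {i j : ℕ} (h1 : 1 ≤ i) (h2 : i ≤ d) (h3 : 1 ≤ j) (h4 : j ≤ d) {s : ℤ} {x : M}
    (hx : G.K i • x = qv ^ s • x) : G.K i • G.f j • x = qv ^ (s - cartan i j) • G.f j • x := by
  have h : G.K i * G.f j = (qv ^ (-cartan i j)) • (G.f j * G.K i) := by
    rw [← smul_mul_assoc, ← G.K_f_Kinv i j h1 h2 h3 h4, mul_assoc, G.Kinv_mul_K i h1 h2, mul_one]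
  rw [smul_smul, h, smul_assoc, mul_smul, hx, smul_comm (G.f j), smul_smul, sub_eq_add_neg,
    add_comm, zpow_add₀ qv_ne_zero]

theorem cartan_self (i : ℕ) : cartan i i = 2 := by simp [cartan]

variable {G} in
theorem K_smul_e_pow {i j : ℕ} (h1 : 1 ≤ i) (h2 : i ≤ d) (h3 : 1 ≤ j) (h4 : j ≤ d) {s : ℤ} {x : M}
    (hx : G.K i • x = qv ^ s • x) (n : ℕ) :
    G.K i • G.e j ^ n • x = qv ^ (s + n * cartan i j) • G.e j ^ n • x := by
  induction n with
  | zero => simpa using hx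
  | succ n ih =>
    rw [pow_succ', mul_smul, K_smul_e_smul h1 h2 h3 h4 ih]
    congr 2
    push_cast
    ring

variable {G} in
theorem K_smul_f_pow {i j : ℕ} (h1 : 1 ≤ i) (h2 : i ≤ d) (h3 : 1 ≤ j) (h4 : j ≤ d) {s : ℤ} {x : M}
    (hx : G.K i • x = qv ^ s • x) (n : ℕ) :
    G.K i • G.f j ^ n • x = qv ^ (s - n * cartan i j) • G.f j ^ n • x := by
  induction n with
  | zero => simpa using hx
  | succ n ih =>
    rw [pow_succ', mul_smul, K_smul_f_smul h1 h2 h3 h4 ih]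
    congr 2
    push_cast
    ring

variable {G} in
theorem e_f_smul {i : ℕ} (h1 : 1 ≤ i) (h2 : i ≤ d) {s : ℤ} {x : M}
    (hx : G.K i • x = qv ^ s • x) :
    G.e i • G.f i • x = G.f i • G.e i • x + qIntZ s • x := by
  have h := G.e_f_comm i i h1 h2 h1 h2
  rw [if_pos rfl, sub_eq_iff_eq_add] at h
  rw [smul_smul, h, add_smul, smul_assoc, sub_smul, hx, Kinv_smul_of_K_smul h1 h2 hx, ← sub_smul,
    smul_smul (qv - qv⁻¹)⁻¹, mul_smul (G.f i), add_comm, qIntZ, div_eq_inv_mul]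

variable {G} in
theorem e_smul_f_pow {i : ℕ} (h1 : 1 ≤ i) (h2 : i ≤ d) {s : ℤ} {x : M}
    (hx : G.K i • x = qv ^ s • x) (n : ℕ) :
    G.e i • G.f i ^ (n + 1) • x =
      G.f i ^ (n + 1) • G.e i • x + (qIntZ (n + 1) * qIntZ (s - n)) • G.f i ^ n • x := by
  induction n with
  | zero => simp [e_f_smul h1 h2 hx, qIntZ_one]
  | succ n ih =>
    rw [pow_succ' _ (n + 1), mul_smul, e_f_smul h1 h2 (K_smul_f_pow h1 h2 h1 h2 hx (n + 1)), ih,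
      smul_add, smul_comm (G.f i) (_ : KK), ← mul_smul (G.f i) (G.f i ^ n),
      ← mul_smul (G.f i) (G.f i ^ (n + 1)), ← pow_succ', ← pow_succ', add_assoc, ← add_smul]
    congr 2
    have := qIntZ_string (n + 1) s
    rw [cartan_self]
    push_cast
    rw [this]
    congr 2 <;> ring_nf

variable {G} in
theorem e_pow_smul_f {i : ℕ} (h1 : 1 ≤ i) (h2 : i ≤ d) {s : ℤ} {x : M}
    (hx : G.K i • x = qv ^ s • x) (n : ℕ) :
    G.e i ^ (n + 1) • G.f i • x =
      G.f i • G.e i ^ (n + 1) • x + (qIntZ (n + 1) * qIntZ (s + n)) • G.e i ^ n • x := by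
  induction n with
  | zero => simp [e_f_smul h1 h2 hx, qIntZ_one]
  | succ n ih =>
    rw [pow_succ' _ (n + 1), mul_smul, ih, smul_add,
      e_f_smul h1 h2 (K_smul_e_pow h1 h2 h1 h2 hx (n + 1)), smul_comm (G.e i) (_ : KK),
      ← mul_smul (G.e i) (G.e i ^ n), ← mul_smul (G.e i) (G.e i ^ (n + 1)), ← pow_succ',
      ← pow_succ',
      add_assoc, ← add_smul]
    congr 2
    rw [cartan_self, add_comm (qIntZ _)]
    have := qIntZ_string' (n + 1) s
    push_cast
    rw [this]
    congr 2 <;> ring_nf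

variable {G} in
/-- `f_i` acts nilpotently on a weight vector of a finite dimensional module. -/
theorem exists_f_pow_smul_eq_zero [FiniteDimensional KK M] {i : ℕ} (h1 : 1 ≤ i) (h2 : i ≤ d) {s : ℤ}
    {x : M} (hx : G.K i • x = qv ^ s • x) : ∃ n : ℕ, G.f i ^ n • x = 0 := by
  by_contra! hne
  let T : Module.End KK M :=
    LinearMap.mk ⟨fun y => G.K i • y, smul_add _⟩ fun c y => smul_comm _ _ _
  have hinj : Function.Injective fun n : ℕ => qv ^ (s - n * cartan i i) := by
    intro n n' h
    have := qv_zpow_injective h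
    rw [cartan_self] at this
    omega
  have := Module.End.eigenvectors_linearIndependent' T _ hinj (fun n : ℕ => G.f i ^ n • x)
    fun n => ⟨Module.End.mem_eigenspace_iff.mpr (K_smul_f_pow h1 h2 h1 h2 hx n), hne n⟩
  exact @not_finite ℕ _ this.finite

end Rank

section Strings

variable {M : Type} [AddCommGroup M] [Module KK M] [Module G.U M] [IsScalarTower KK G.U M]

variable {G} in
theorem e_pow_eq_zero_of_neg [FiniteDimensional KK M] {i : ℕ} (h1 : 1 ≤ i) (h2 : i ≤ d) {s : ℤ}
    {x : M} (hx : G.K i • x = qv ^ s • x) {N : ℕ} (he : G.e i ^ (N + 1) • x = 0)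
    (hs : s + N < 0) : G.e i ^ N • x = 0 := by
  by_contra hne
  have key : ∀ n : ℕ, G.e i ^ (N + n + 1) • G.f i ^ n • x = 0 ∧
      G.e i ^ (N + n) • G.f i ^ n • x ≠ 0 := by
    intro n
    induction n with
    | zero => simpa using ⟨he, hne⟩
    | succ n ih =>
      have hw := K_smul_f_pow h1 h2 h1 h2 hx n
      rw [cartan_self] at hw
      have hp : G.f i ^ (n + 1) • x = G.f i • G.f i ^ n • x := by rw [pow_succ', mul_smul]
      rw [hp, ← add_assoc, e_pow_smul_f h1 h2 hw (N + n), e_pow_smul_f h1 h2 hw (N + n + 1),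
        pow_succ' _ (N + n + 1), mul_smul (G.e i), ih.1]
      refine ⟨by simp, ?_⟩
      rw [smul_zero, zero_add]
      refine smul_ne_zero (mul_ne_zero (qIntZ_ne_zero ?_) (qIntZ_ne_zero ?_)) ih.2
      · push_cast
        omega
      · push_cast
        omega
  obtain ⟨n, hn⟩ := exists_f_pow_smul_eq_zero h1 h2 hx
  exact (key n).2 (by rw [hn, smul_zero])

variable {G} in
theorem eq_zero_of_e_smul_of_neg [FiniteDimensional KK M] {i : ℕ} (h1 : 1 ≤ i) (h2 : i ≤ d) {s : ℤ}
    {x : M} (hx : G.K i • x = qv ^ s • x) (he : G.e i • x = 0) (hs : s < 0) : x = 0 := by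
  simpa using e_pow_eq_zero_of_neg h1 h2 hx (N := 0) (by simpa using he) (by simpa using hs)

variable {G} in
theorem f_pow_eq_zero_of_lt [FiniteDimensional KK M] {i : ℕ} (h1 : 1 ≤ i) (h2 : i ≤ d) {s : ℤ}
    {x : M} (hx : G.K i • x = qv ^ s • x) (he : G.e i • x = 0) {n : ℕ} (hn : s < n) :
    G.f i ^ n • x = 0 := by
  by_cases hs : s < 0
  · rw [eq_zero_of_e_smul_of_neg h1 h2 hx he hs, smul_zero]
  lift s to ℕ using not_lt.mp hs
  have hz : G.f i ^ (s + 1) • x = 0 := by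
    refine eq_zero_of_e_smul_of_neg h1 h2 (K_smul_f_pow h1 h2 h1 h2 hx (s + 1)) ?_ ?_
    · rw [e_smul_f_pow h1 h2 hx, he]
      simp [qIntZ_zero]
    · rw [cartan_self]
      push_cast
      omega
  obtain ⟨t, rfl⟩ : ∃ t, n = t + (s + 1) := ⟨n - (s + 1), by omega⟩
  rw [pow_add, mul_smul, hz, smul_zero]

theorem fDiv_smul (i n : ℕ) (x : M) : fDiv G i n • x = (qFact n)⁻¹ • G.f i ^ n • x := by
  rw [fDiv, smul_assoc]

theorem fDiv_zero_smul (i : ℕ) (x : M) : fDiv G i 0 • x = x := by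
  simp [fDiv, qFact]

theorem f_pow_smul_eq (i n : ℕ) (x : M) : G.f i ^ n • x = qFact n • fDiv G i n • x := by
  rw [fDiv_smul, smul_smul, mul_inv_cancel₀ (qFact_ne_zero n), one_smul]

theorem f_smul_fDiv (i n : ℕ) (x : M) :
    G.f i • fDiv G i n • x = qInt (n + 1) • fDiv G i (n + 1) • x := by
  rw [fDiv_smul, fDiv_smul, smul_comm (G.f i) (_ : KK), ← mul_smul (G.f i), ← pow_succ',
    smul_smul (qInt (n + 1)), qFact, mul_inv_rev, ← mul_assoc,
    mul_inv_cancel₀ (qInt_succ_ne_zero n), one_mul]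

variable {G} in
theorem fDiv_eq_zero_of_lt [FiniteDimensional KK M] {i : ℕ} (h1 : 1 ≤ i) (h2 : i ≤ d) {s : ℤ}
    {x : M} (hx : G.K i • x = qv ^ s • x) (he : G.e i • x = 0) {n : ℕ} (hn : s < n) :
    fDiv G i n • x = 0 := by
  rw [fDiv_smul, f_pow_eq_zero_of_lt h1 h2 hx he hn, smul_zero]

variable {G} in
theorem e_smul_fDiv_succ {i : ℕ} (h1 : 1 ≤ i) (h2 : i ≤ d) {s : ℤ} {x : M}
    (hx : G.K i • x = qv ^ s • x) (he : G.e i • x = 0) (n : ℕ) :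
    G.e i • fDiv G i (n + 1) • x = qIntZ (s - n) • fDiv G i n • x := by
  rw [fDiv_smul, fDiv_smul, smul_comm (G.e i) (_ : KK), e_smul_f_pow h1 h2 hx, he, smul_zero,
    zero_add, smul_smul, smul_smul, qFact, qInt_eq, mul_inv_rev]
  push_cast
  congr 1
  have : qIntZ ((n : ℤ) + 1) ≠ 0 := qIntZ_ne_zero (by omega)
  field_simp

variable {G} in
theorem e_pow_smul_fDiv {i : ℕ} (h1 : 1 ≤ i) (h2 : i ≤ d) {s : ℤ} {x : M}
    (hx : G.K i • x = qv ^ s • x) (he : G.e i • x = 0) (n : ℕ) :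
    G.e i ^ n • fDiv G i n • x = (∏ r ∈ Finset.range n, qIntZ (s - r)) • x := by
  induction n with
  | zero => simp [fDiv_zero_smul]
  | succ n ih =>
    rw [pow_succ, mul_smul, e_smul_fDiv_succ h1 h2 hx he, smul_comm (_ : G.U) (_ : KK), ih,
      smul_smul, Finset.prod_range_succ, mul_comm]

variable {G} in
theorem e_pow_smul_fDiv_of_lt {i : ℕ} (h1 : 1 ≤ i) (h2 : i ≤ d) {s : ℤ} {x : M}
    (hx : G.K i • x = qv ^ s • x) (he : G.e i • x = 0) {n N : ℕ} (hn : n < N) :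
    G.e i ^ N • fDiv G i n • x = 0 := by
  obtain ⟨t, rfl⟩ : ∃ t, N = t + 1 + n := ⟨N - n - 1, by omega⟩
  rw [pow_add, mul_smul, e_pow_smul_fDiv h1 h2 hx he, smul_comm (_ : G.U) (_ : KK), pow_succ,
    mul_smul, he, smul_zero, smul_zero]

theorem prod_qIntZ_ne_zero {s : ℤ} {n : ℕ} (h : (n : ℤ) ≤ s) :
    ∏ r ∈ Finset.range n, qIntZ (s - r) ≠ 0 := by
  refine Finset.prod_ne_zero_iff.mpr fun r hr => qIntZ_ne_zero ?_
  have := Finset.mem_range.mp hr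
  omega

variable {G} in
/-- uniqueness of string decompositions. -/
theorem fDiv_eq_zero_of_sum_eq_zero [FiniteDimensional KK M] {i : ℕ} (h1 : 1 ≤ i) (h2 : i ≤ d)
    {s : ℤ} {w : ℕ → M} {N : ℕ} (he : ∀ n < N, G.e i • w n = 0)
    (hw : ∀ n < N, G.K i • w n = qv ^ (s + 2 * n) • w n)
    (h0 : ∑ n ∈ Finset.range N, fDiv G i n • w n = 0) : ∀ n < N, fDiv G i n • w n = 0 := by
  induction N with
  | zero => intro n hn; omega
  | succ N ih =>
    have hN : fDiv G i N • w N = 0 := by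
      by_cases hlt : s + 2 * N < N
      · exact fDiv_eq_zero_of_lt h1 h2 (hw N (by omega)) (he N (by omega)) hlt
      have h := congrArg (fun y => G.e i ^ N • y) h0
      simp only [Finset.sum_range_succ, smul_add, Finset.smul_sum, smul_zero] at h
      rw [Finset.sum_eq_zero fun n hn => ?_, zero_add,
        e_pow_smul_fDiv h1 h2 (hw N (by omega)) (he N (by omega))] at h
      · rw [(smul_eq_zero.mp h).resolve_left (prod_qIntZ_ne_zero (not_lt.mp hlt)), smul_zero]
      · have := Finset.mem_range.mp hn
        exact e_pow_smul_fDiv_of_lt h1 h2 (hw n (by omega)) (he n (by omega)) this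
    rw [Finset.sum_range_succ, hN, add_zero] at h0
    intro n hn
    rcases Nat.lt_succ_iff_lt_or_eq.mp hn with h | rfl
    · exact ih (fun n hn => he n (by omega)) (fun n hn => hw n (by omega)) h0 n h
    · exact hN

theorem fDiv_succ_eq_zero {i n : ℕ} {x : M} (h : fDiv G i n • x = 0) :
    fDiv G i (n + 1) • x = 0 := by
  have := f_smul_fDiv G i n x
  rw [h, smul_zero] at this
  exact (smul_eq_zero.mp this.symm).resolve_left (qInt_succ_ne_zero n)

variable {G} in
theorem IsWtVec.f_smul {x : M} {μ : ℕ → ℤ} (hx : IsWtVec G x μ) {j : ℕ} (h3 : 1 ≤ j) (h4 : j ≤ d) :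
    IsWtVec G (G.f j • x) fun t => μ t - cartan t j :=
  fun i h1 h2 => K_smul_f_smul h1 h2 h3 h4 (hx i h1 h2)

variable {G} in
theorem IsWtVec.e_pow {x : M} {μ : ℕ → ℤ} (hx : IsWtVec G x μ) {j : ℕ} (h3 : 1 ≤ j) (h4 : j ≤ d)
    (n : ℕ) : IsWtVec G (G.e j ^ n • x) fun t => μ t + n * cartan t j :=
  fun i h1 h2 => K_smul_e_pow h1 h2 h3 h4 (hx i h1 h2) n

variable {G} in
theorem IsWtVec.f_pow {x : M} {μ : ℕ → ℤ} (hx : IsWtVec G x μ) {j : ℕ} (h3 : 1 ≤ j) (h4 : j ≤ d)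
    (n : ℕ) : IsWtVec G (G.f j ^ n • x) fun t => μ t - n * cartan t j :=
  fun i h1 h2 => K_smul_f_pow h1 h2 h3 h4 (hx i h1 h2) n

variable {G} in
theorem IsWtVec.smul {x : M} {μ : ℕ → ℤ} (hx : IsWtVec G x μ) (c : KK) : IsWtVec G (c • x) μ :=
  fun i h1 h2 => by rw [smul_comm, hx i h1 h2, smul_comm]

variable {G} in
theorem IsWtVec.fDiv {x : M} {μ : ℕ → ℤ} (hx : IsWtVec G x μ) {j : ℕ} (h3 : 1 ≤ j) (h4 : j ≤ d)
    (n : ℕ) : IsWtVec G (fDiv G j n • x) fun t => μ t - n * cartan t j := by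
  rw [fDiv_smul]
  exact (hx.f_pow h3 h4 n).smul _

variable {G} in
theorem IsWtVec.add {x y : M} {μ : ℕ → ℤ} (hx : IsWtVec G x μ) (hy : IsWtVec G y μ) :
    IsWtVec G (x + y) μ :=
  fun i h1 h2 => by rw [smul_add, hx i h1 h2, hy i h1 h2, smul_add]

variable {G} in
theorem IsWtVec.sub {x y : M} {μ : ℕ → ℤ} (hx : IsWtVec G x μ) (hy : IsWtVec G y μ) :
    IsWtVec G (x - y) μ :=
  fun i h1 h2 => by rw [smul_sub, hx i h1 h2, hy i h1 h2, smul_sub]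

variable {G} in
theorem IsWtVec.zero (μ : ℕ → ℤ) : IsWtVec G (0 : M) μ :=
  fun i h1 h2 => by rw [smul_zero, smul_zero]

variable {G} in
theorem IsWtVec.sum {ι : Type} {S : Finset ι} {w : ι → M} {μ : ℕ → ℤ}
    (h : ∀ n ∈ S, IsWtVec G (w n) μ) : IsWtVec G (∑ n ∈ S, w n) μ :=
  fun i h1 h2 => by
    rw [Finset.smul_sum, Finset.smul_sum]
    exact Finset.sum_congr rfl fun n hn => h n hn i h1 h2

variable {G} in
/-- existence of string decompositions, inside any subspace stable under the `f_i^b e_i^b`. -/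
theorem exists_kashDecomp [FiniteDimensional KK M] {i : ℕ} (h1 : 1 ≤ i) (h2 : i ≤ d)
    {μ : ℕ → ℤ} (Q : Submodule KK M) (hQ : ∀ b : ℕ, ∀ z ∈ Q, G.f i ^ b • G.e i ^ b • z ∈ Q)
    (N : ℕ) {x : M} (hxQ : x ∈ Q) (hx : IsWtVec G x μ) (he : G.e i ^ N • x = 0) :
    ∃ w : ℕ → M, (∀ n, G.e i • w n = 0 ∧ IsWtVec G (w n) fun t => μ t + n * cartan t i) ∧
      x = ∑ n ∈ Finset.range N, fDiv G i n • w n ∧ ∀ n, fDiv G i n • w n ∈ Q := by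
  induction N generalizing x with
  | zero =>
    refine ⟨fun _ => 0, fun n => ⟨smul_zero _, IsWtVec.zero _⟩, ?_, fun n => ?_⟩
    · simpa using he
    · rw [smul_zero]
      exact Q.zero_mem
  | succ N ih =>
    have hKx := hx i h1 h2
    by_cases hneg : μ i + N < 0
    · obtain ⟨w, hw, hsum, hwQ⟩ := ih hxQ hx (e_pow_eq_zero_of_neg h1 h2 hKx he hneg)
      refine ⟨fun n => if n < N then w n else 0, fun n => ?_, ?_, fun n => ?_⟩
      · by_cases hn : n < N
        · simp only [if_pos hn]
          exact hw n
        · simp only [if_neg hn]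
          exact ⟨smul_zero _, IsWtVec.zero _⟩
      · dsimp only
        rw [Finset.sum_range_succ, if_neg (lt_irrefl N), smul_zero, add_zero, hsum]
        exact Finset.sum_congr rfl fun n hn => by rw [if_pos (Finset.mem_range.mp hn)]
      · by_cases hn : n < N
        · simpa only [if_pos hn] using hwQ n
        · simp only [if_neg hn, smul_zero, Q.zero_mem]
    · set y := G.e i ^ N • x with hy
      have hey : G.e i • y = 0 := by rw [hy, ← mul_smul, ← pow_succ', he]
      have hwy := hx.e_pow h1 h2 N
      have hKy := hwy i h1 h2
      dsimp only at hKy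
      rw [cartan_self, ← hy] at hKy
      set c := ∏ r ∈ Finset.range N, qIntZ (μ i + N * 2 - r) with hc
      have hc0 : c ≠ 0 := prod_qIntZ_ne_zero (by omega)
      have hQy : fDiv G i N • c⁻¹ • y ∈ Q := by
        rw [smul_comm, fDiv_smul]
        exact Q.smul_mem _ (Q.smul_mem _ (hQ N x hxQ))
      have hwtop : IsWtVec G (fDiv G i N • c⁻¹ • y) μ := by
        have := (hwy.smul c⁻¹).fDiv h1 h2 N
        simpa only [add_sub_cancel_right] using this
      have he' : G.e i ^ N • (x - fDiv G i N • c⁻¹ • y) = 0 := by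
        rw [smul_sub, smul_comm _ c⁻¹ y, smul_comm _ c⁻¹ (fDiv G i N • y),
          e_pow_smul_fDiv h1 h2 hKy hey, smul_smul, ← hc, inv_mul_cancel₀ hc0, one_smul, ← hy,
          sub_self]
      obtain ⟨w, hw, hsum, hwQ⟩ := ih (Q.sub_mem hxQ hQy) (hx.sub hwtop) he'
      refine ⟨fun n => if n = N then c⁻¹ • y else w n, fun n => ?_, ?_, fun n => ?_⟩
      · by_cases hn : n = N
        · subst hn
          simp only [if_true]
          exact ⟨by rw [smul_comm, hey, smul_zero], hwy.smul _⟩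
        · simp only [if_neg hn]
          exact hw n
      · dsimp only
        rw [Finset.sum_range_succ, if_pos rfl, ← sub_eq_iff_eq_add, hsum]
        exact Finset.sum_congr rfl fun n hn => by rw [if_neg (Finset.mem_range.mp hn).ne]
      · by_cases hn : n = N
        · subst hn
          simpa only [if_true] using hQy
        · simpa only [if_neg hn] using hwQ n

end Strings

theorem cartan_comm (i j : ℕ) : cartan i j = cartan j i := by
  unfold cartan
  split_ifs <;> omega

section Kashiwara

variable {M : Type} [AddCommGroup M] [Module KK M] [Module G.U M] [IsScalarTower KK G.U M]

variable {G} in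
/-- `e_i` acts nilpotently on a weight vector of a finite dimensional module. -/
theorem exists_e_pow_smul_eq_zero [FiniteDimensional KK M] {i : ℕ} (h1 : 1 ≤ i) (h2 : i ≤ d) {s : ℤ}
    {x : M} (hx : G.K i • x = qv ^ s • x) : ∃ n : ℕ, G.e i ^ n • x = 0 := by
  by_contra! hne
  let T : Module.End KK M :=
    LinearMap.mk ⟨fun y => G.K i • y, smul_add _⟩ fun c y => smul_comm _ _ _
  have hinj : Function.Injective fun n : ℕ => qv ^ (s + n * cartan i i) := by
    intro n n' h
    have := qv_zpow_injective h
    rw [cartan_self] at this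
    omega
  have := Module.End.eigenvectors_linearIndependent' T _ hinj (fun n : ℕ => G.e i ^ n • x)
    fun n => ⟨Module.End.mem_eigenspace_iff.mpr (K_smul_e_pow h1 h2 h1 h2 hx n), hne n⟩
  exact @not_finite ℕ _ this.finite

theorem sum_fDiv_extend (i c : ℕ) (w : ℕ → M) {N P : ℕ} (h : N ≤ P) :
    ∑ n ∈ Finset.range P, fDiv G i (n + c) • (if n < N then w n else 0) =
      ∑ n ∈ Finset.range N, fDiv G i (n + c) • w n := by
  rw [← Finset.sum_subset (Finset.range_mono h)]
  · exact Finset.sum_congr rfl fun n hn => by rw [if_pos (Finset.mem_range.mp hn)]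
  · intro n _ hn
    rw [if_neg (fun h => hn (Finset.mem_range.mpr h)), smul_zero]

variable {G} in
theorem sum_fDiv_succ_unique [FiniteDimensional KK M] {i : ℕ} (h1 : 1 ≤ i) (h2 : i ≤ d)
    {s : ℤ} {w w' : ℕ → M} {N N' : ℕ} (he : ∀ n < N, G.e i • w n = 0)
    (hw : ∀ n < N, G.K i • w n = qv ^ (s + 2 * n) • w n) (he' : ∀ n < N', G.e i • w' n = 0)
    (hw' : ∀ n < N', G.K i • w' n = qv ^ (s + 2 * n) • w' n)
    (h : ∑ n ∈ Finset.range N, fDiv G i n • w n = ∑ n ∈ Finset.range N', fDiv G i n • w' n) :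
    ∑ n ∈ Finset.range N, fDiv G i (n + 1) • w n =
      ∑ n ∈ Finset.range N', fDiv G i (n + 1) • w' n := by
  have e0 := sum_fDiv_extend G i 0 w (le_max_left N N')
  have e0' := sum_fDiv_extend G i 0 w' (le_max_right N N')
  have e1 := sum_fDiv_extend G i 1 w (le_max_left N N')
  have e1' := sum_fDiv_extend G i 1 w' (le_max_right N N')
  simp only [add_zero] at e0 e0'
  rw [← e0, ← e0', ← sub_eq_zero, ← Finset.sum_sub_distrib] at h
  rw [← e1, ← e1', ← sub_eq_zero, ← Finset.sum_sub_distrib]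
  simp only [← smul_sub] at h ⊢
  refine Finset.sum_eq_zero fun n hn => fDiv_succ_eq_zero G ?_
  refine fDiv_eq_zero_of_sum_eq_zero h1 h2 (s := s) ?_ ?_ h n (Finset.mem_range.mp hn)
  · intro n _
    rw [smul_sub]
    split_ifs <;> simp_all
  · intro n _
    rw [smul_sub, smul_sub]
    congr 1 <;> split_ifs <;> simp_all

variable {G} in
theorem exists_string [FiniteDimensional KK M] {i : ℕ} (h1 : 1 ≤ i) (h2 : i ≤ d)
    {μ : ℕ → ℤ} {x : M} (hx : IsWtVec G x μ) :
    ∃ N : ℕ, ∃ w : ℕ → M, (∀ n, G.e i • w n = 0 ∧ IsWtVec G (w n) fun t => μ t + n * cartan t i) ∧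
      x = ∑ n ∈ Finset.range (N + 1), fDiv G i n • w n := by
  obtain ⟨N, hN⟩ := exists_e_pow_smul_eq_zero h1 h2 (hx i h1 h2)
  obtain ⟨w, hw, hs, -⟩ := exists_kashDecomp h1 h2 ⊤ (fun _ _ _ => Submodule.mem_top) (N + 1)
    Submodule.mem_top hx (by rw [pow_succ', mul_smul, hN, smul_zero])
  exact ⟨N, w, hw, hs⟩

variable {G} in
theorem kashF_eq [FiniteDimensional KK M] {i : ℕ} (h1 : 1 ≤ i) (h2 : i ≤ d)
    {μ : ℕ → ℤ} {u : M} (hu : IsWtVec G u μ) {s : ℤ} {w : ℕ → M} {N : ℕ}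
    (he : ∀ n < N, G.e i • w n = 0)
    (hw : ∀ n < N, G.K i • w n = qv ^ (s + 2 * n) • w n)
    (h : u = ∑ n ∈ Finset.range N, fDiv G i n • w n) :
    kashF G i u = ∑ n ∈ Finset.range N, fDiv G i (n + 1) • w n := by
  have hex : ∃ p : ℕ × (ℕ → M) × (ℕ → ℤ), KashDecomp G i u p := by
    obtain ⟨N', w', hw', hs⟩ := exists_string h1 h2 hu
    exact ⟨(N', w', μ), hu,
      fun n _ => ⟨(hw' n).1, by simpa only [cartan_comm i] using (hw' n).2⟩, hs⟩
  rw [kashF, dif_pos hex]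
  obtain ⟨hc1, hc2, hc3⟩ := hex.choose_spec
  generalize hex.choose = p at hc1 hc2 hc3
  have hKp : ∀ n < p.1 + 1, G.K i • p.2.1 n = qv ^ (p.2.2 i + 2 * n) • p.2.1 n := by
    intro n hn
    have := (hc2 n (by omega)).2 i h1 h2
    dsimp only at this
    rwa [cartan_self, mul_comm] at this
  have hep : ∀ n < p.1 + 1, G.e i • p.2.1 n = 0 := fun n hn => (hc2 n (by omega)).1
  by_cases hu0 : u = 0
  · rw [hu0] at h hc3
    rw [Finset.sum_eq_zero, Finset.sum_eq_zero]
    · exact fun n hn => fDiv_succ_eq_zero G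
        (fDiv_eq_zero_of_sum_eq_zero h1 h2 he hw h.symm n (Finset.mem_range.mp hn))
    · exact fun n hn => fDiv_succ_eq_zero G
        (fDiv_eq_zero_of_sum_eq_zero h1 h2 hep hKp hc3.symm n (Finset.mem_range.mp hn))
  · have hs : p.2.2 i = s := by
      have hKu : G.K i • u = qv ^ s • u := by
        rw [h, Finset.smul_sum, Finset.smul_sum]
        refine Finset.sum_congr rfl fun n hn => ?_
        rw [fDiv_smul, smul_comm (G.K i) (_ : KK),
          K_smul_f_pow h1 h2 h1 h2 (hw n (Finset.mem_range.mp hn)), cartan_self,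
          smul_comm (qv ^ s) ((qFact n)⁻¹ : KK)]
        congr 3
        ring
      rw [hc1 i h1 h2] at hKu
      exact qv_zpow_injective (smul_left_injective KK hu0 hKu)
    rw [hs] at hKp
    exact sum_fDiv_succ_unique h1 h2 hep hKp he hw (hc3.symm.trans h)

variable {G} in
theorem K_smul_of_string {i : ℕ} (h1 : 1 ≤ i) (h2 : i ≤ d) {μ : ℕ → ℤ} {y : M} {n : ℕ}
    (h : IsWtVec G y fun t => μ t + n * cartan t i) :
    G.K i • y = qv ^ (μ i + 2 * n) • y := by
  have := h i h1 h2
  dsimp only at this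
  rwa [cartan_self, mul_comm] at this

variable {G} in
theorem kashF_add_smul [FiniteDimensional KK M] {i : ℕ} (h1 : 1 ≤ i) (h2 : i ≤ d)
    {μ : ℕ → ℤ} {x y : M} (hx : IsWtVec G x μ) (hy : IsWtVec G y μ) (c : KK) :
    kashF G i (x + c • y) = kashF G i x + c • kashF G i y := by
  obtain ⟨N, w, hw, hs⟩ := exists_string h1 h2 hx
  obtain ⟨N', w', hw', hs'⟩ := exists_string h1 h2 hy
  rw [kashF_eq h1 h2 hx (fun n _ => (hw n).1) (fun n _ => K_smul_of_string h1 h2 (hw n).2) hs,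
    kashF_eq h1 h2 hy (fun n _ => (hw' n).1) (fun n _ => K_smul_of_string h1 h2 (hw' n).2) hs',
    kashF_eq h1 h2 (hx.add (hy.smul c)) (s := μ i) (N := max (N + 1) (N' + 1))
      (w := fun n => (if n < N + 1 then w n else 0) + c • (if n < N' + 1 then w' n else 0)),
    ← sum_fDiv_extend G i 1 w (le_max_left (N + 1) (N' + 1)),
    ← sum_fDiv_extend G i 1 w' (le_max_right (N + 1) (N' + 1)), Finset.smul_sum,
    ← Finset.sum_add_distrib]
  · exact Finset.sum_congr rfl fun n _ => by rw [smul_add, smul_comm c]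
  · intro n _
    rw [smul_add, smul_comm _ c]
    split_ifs <;> simp [(hw n).1, (hw' n).1]
  · intro n _
    have := K_smul_of_string h1 h2 (hw n).2
    have := K_smul_of_string h1 h2 (hw' n).2
    rw [smul_add, smul_add, smul_comm _ c, smul_comm _ c]
    split_ifs <;> simp_all
  · have e0 := sum_fDiv_extend G i 0 w (le_max_left (N + 1) (N' + 1))
    have e0' := sum_fDiv_extend G i 0 w' (le_max_right (N + 1) (N' + 1))
    simp only [add_zero] at e0 e0'
    conv_lhs => rw [hs, hs']
    rw [← e0, ← e0', Finset.smul_sum, ← Finset.sum_add_distrib]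
    exact Finset.sum_congr rfl fun n _ => by rw [smul_add, smul_comm c]

variable {G} in
theorem IsWtVec.kashF [FiniteDimensional KK M] {i : ℕ} (h1 : 1 ≤ i) (h2 : i ≤ d)
    {μ : ℕ → ℤ} {x : M} (hx : IsWtVec G x μ) :
    IsWtVec G (kashF G i x) fun t => μ t - cartan t i := by
  obtain ⟨N, w, hw, hs⟩ := exists_string h1 h2 hx
  rw [kashF_eq h1 h2 hx (fun n _ => (hw n).1) (fun n _ => K_smul_of_string h1 h2 (hw n).2) hs]
  refine IsWtVec.sum fun n _ => ?_
  have := (hw n).2.fDiv h1 h2 (n + 1)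
  convert this using 2
  push_cast
  ring

variable {G} in
theorem kashF_fDiv_smul [FiniteDimensional KK M] {i : ℕ} (h1 : 1 ≤ i) (h2 : i ≤ d)
    {μ : ℕ → ℤ} {x : M} (hx : IsWtVec G x μ) (he : G.e i • x = 0) (t : ℕ) :
    kashF G i (fDiv G i t • x) = fDiv G i (t + 1) • x := by
  rw [kashF_eq h1 h2 (hx.fDiv h1 h2 t) (s := μ i - 2 * t) (N := t + 1)
    (w := fun n => if n = t then x else 0), Finset.sum_eq_single t]
  · simp
  · intro n _ hn
    simp [hn]
  · simp
  · intro n _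
    split_ifs <;> simp [he]
  · intro n _
    split_ifs with h
    · subst h
      rw [sub_add_cancel]
      exact hx i h1 h2
    · simp
  · rw [Finset.sum_eq_single t]
    · simp
    · intro n _ hn
      simp [hn]
    · simp

end Kashiwara

section Intertwine

variable {d' : ℕ} {G' : QGroup d'}
variable {M : Type} [AddCommGroup M] [Module KK M] [Module G.U M] [IsScalarTower KK G.U M]
variable {M' : Type} [AddCommGroup M'] [Module KK M'] [Module G'.U M'] [IsScalarTower KK G'.U M']

variable {G} in
theorem map_fDiv_smul {φ : M' →ₗ[KK] M} {i : ℕ} (hf : ∀ x, φ (G'.f i • x) = G.f i • φ x)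
    (n : ℕ) (x : M') : φ (fDiv G' i n • x) = fDiv G i n • φ x := by
  have : ∀ n : ℕ, φ (G'.f i ^ n • x) = G.f i ^ n • φ x := by
    intro n
    induction n with
    | zero => simp
    | succ n ih => rw [pow_succ', mul_smul, hf, ih, ← mul_smul, ← pow_succ']
  rw [fDiv_smul, fDiv_smul, map_smul, this]

variable {G} in
theorem map_kashF [FiniteDimensional KK M] [FiniteDimensional KK M'] {φ : M' →ₗ[KK] M} {i : ℕ}
    (h1 : 1 ≤ i) (h2 : i ≤ d) (h2' : i ≤ d')
    (he : ∀ x, φ (G'.e i • x) = G.e i • φ x) (hf : ∀ x, φ (G'.f i • x) = G.f i • φ x)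
    (hK : ∀ x, φ (G'.K i • x) = G.K i • φ x) {μ ν : ℕ → ℤ} {x : M'} (hx : IsWtVec G' x μ)
    (hφx : IsWtVec G (φ x) ν) : φ (kashF G' i x) = kashF G i (φ x) := by
  obtain ⟨N, w, hw, hs⟩ := exists_string h1 h2' hx
  rw [kashF_eq h1 h2' hx (fun n _ => (hw n).1) (fun n _ => K_smul_of_string h1 h2' (hw n).2) hs,
    kashF_eq h1 h2 hφx (s := μ i) (N := N + 1) (w := fun n => φ (w n)), map_sum]
  · exact Finset.sum_congr rfl fun n _ => map_fDiv_smul hf _ _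
  · intro n _
    rw [← he, (hw n).1, map_zero]
  · intro n _
    rw [← hK, K_smul_of_string h1 h2' (hw n).2, map_smul]
  · conv_lhs => rw [hs]
    rw [map_sum]
    exact Finset.sum_congr rfl fun n _ => map_fDiv_smul hf _ _

end Intertwine

section Words

variable {M : Type} [AddCommGroup M] [Module KK M] [Module G.U M] [IsScalarTower KK G.U M]

/-- the vector `f_{i_1} ⋯ f_{i_r} v` for `is = [i_1, …, i_r]`. -/
def word (is : List ℕ) (v : M) : M := is.foldr (fun i x => G.f i • x) v

theorem word_cons (i : ℕ) (is : List ℕ) (v : M) : word G (i :: is) v = G.f i • word G is v := rfl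

/-- the span of the words whose multiset of letters is `s`. -/
def wordSpan (v : M) (s : Multiset ℕ) : Submodule KK M :=
  Submodule.span KK {x | ∃ is : List ℕ, (is : Multiset ℕ) = s ∧ x = word G is v}

/-- the span of the Kashiwara sequences whose multiset of letters is `s`. -/
def kashSpan (v : M) (s : Multiset ℕ) : Submodule KK M :=
  Submodule.span KK {x | ∃ is : List ℕ, (is : Multiset ℕ) = s ∧ x = kashSeq G is v}

variable {G}

theorem word_mem_wordSpan (is : List ℕ) (v : M) : word G is v ∈ wordSpan G v is :=
  Submodule.subset_span ⟨is, rfl, rfl⟩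

theorem f_smul_mem_wordSpan {v : M} {s : Multiset ℕ} {z : M} (hz : z ∈ wordSpan G v s) (i : ℕ) :
    G.f i • z ∈ wordSpan G v (i ::ₘ s) := by
  induction hz using Submodule.span_induction with
  | mem x hx =>
    obtain ⟨is, rfl, rfl⟩ := hx
    exact word_mem_wordSpan (i :: is) v
  | zero => rw [smul_zero]; exact zero_mem _
  | add x y _ _ hx hy => rw [smul_add]; exact add_mem hx hy
  | smul c x _ hx => rw [smul_comm]; exact Submodule.smul_mem _ _ hx

/-- the weight of a word in the letters `s` applied to a vector of weight `lam`. -/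
def letterWt (lam : ℕ → ℤ) (s : Multiset ℕ) : ℕ → ℤ := fun t => lam t - (s.map (cartan t)).sum

theorem letterWt_zero (lam : ℕ → ℤ) : letterWt lam 0 = lam := by
  funext t
  simp [letterWt]

theorem letterWt_cons (lam : ℕ → ℤ) (i : ℕ) (s : Multiset ℕ) :
    letterWt lam (i ::ₘ s) = fun t => letterWt lam s t - cartan t i := by
  funext t
  simp only [letterWt, Multiset.map_cons, Multiset.sum_cons]
  ring

theorem isWtVec_word {lam : ℕ → ℤ} {v : M} (hv : IsWtVec G v lam) :
    ∀ {is : List ℕ}, (∀ i ∈ is, 1 ≤ i ∧ i ≤ d) → IsWtVec G (word G is v) (letterWt lam is)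
  | [], _ => by simpa [word, letterWt_zero] using hv
  | i :: is, his => by
    have hi := his i List.mem_cons_self
    have := (isWtVec_word hv fun j hj => his j (List.mem_cons_of_mem i hj)).f_smul hi.1 hi.2
    rwa [← letterWt_cons, Multiset.cons_coe] at this

theorem e_smul_word {lam : ℕ → ℤ} {v : M} (hv : IsWtVec G v lam)
    (hw : ∀ i, 1 ≤ i → i ≤ d → G.e i • v = 0) {i : ℕ} (h1 : 1 ≤ i) (h2 : i ≤ d) :
    ∀ {is : List ℕ}, (∀ i ∈ is, 1 ≤ i ∧ i ≤ d) →
      G.e i • word G is v ∈ wordSpan G v ((is : Multiset ℕ).erase i) ∧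
        (i ∉ is → G.e i • word G is v = 0)
  | [], _ => by simp [word, hw i h1 h2]
  | j :: is, his => by
    have hj := his j List.mem_cons_self
    have his' : ∀ i ∈ is, 1 ≤ i ∧ i ≤ d := fun l hl => his l (List.mem_cons_of_mem j hl)
    obtain ⟨ih1, ih2⟩ := e_smul_word hv hw h1 h2 his'
    rw [word_cons, ← Multiset.cons_coe]
    by_cases hij : i = j
    · subst hij
      rw [e_f_smul h1 h2 (isWtVec_word hv his' i h1 h2), Multiset.erase_cons_head]
      refine ⟨add_mem ?_ (Submodule.smul_mem _ _ (word_mem_wordSpan is v)), fun h => ?_⟩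
      · by_cases hmem : i ∈ is
        · have := f_smul_mem_wordSpan ih1 i
          rwa [Multiset.cons_erase (Multiset.mem_coe.mpr hmem)] at this
        · rw [ih2 hmem, smul_zero]
          exact zero_mem _
      · exact absurd List.mem_cons_self h
    · rw [e_f_smul_of_ne h1 h2 hj.1 hj.2 hij, Multiset.erase_cons_tail _ (Ne.symm hij)]
      refine ⟨f_smul_mem_wordSpan ih1 j, fun h => ?_⟩
      rw [ih2 fun hmem => h (List.mem_cons_of_mem j hmem), smul_zero]

theorem e_smul_mem_wordSpan {lam : ℕ → ℤ} {v : M} (hv : IsWtVec G v lam)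
    (hw : ∀ i, 1 ≤ i → i ≤ d → G.e i • v = 0) {i : ℕ} (h1 : 1 ≤ i) (h2 : i ≤ d)
    {s : Multiset ℕ} (hs : ∀ i ∈ s, 1 ≤ i ∧ i ≤ d) {z : M} (hz : z ∈ wordSpan G v s) :
    G.e i • z ∈ wordSpan G v (s.erase i) ∧ (i ∉ s → G.e i • z = 0) := by
  induction hz using Submodule.span_induction with
  | mem x hx =>
    obtain ⟨is, rfl, rfl⟩ := hx
    exact e_smul_word hv hw h1 h2 hs
  | zero => rw [smul_zero]; exact ⟨zero_mem _, fun _ => rfl⟩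
  | add x y _ _ hx hy =>
    rw [smul_add]
    exact ⟨add_mem hx.1 hy.1, fun h => by rw [hx.2 h, hy.2 h, add_zero]⟩
  | smul c x _ hx =>
    rw [smul_comm]
    exact ⟨Submodule.smul_mem _ _ hx.1, fun h => by rw [hx.2 h, smul_zero]⟩

theorem f_pow_e_pow_smul_mem_wordSpan {lam : ℕ → ℤ} {v : M} (hv : IsWtVec G v lam)
    (hw : ∀ i, 1 ≤ i → i ≤ d → G.e i • v = 0) {i : ℕ} (h1 : 1 ≤ i) (h2 : i ≤ d) (b : ℕ) :
    ∀ {s : Multiset ℕ}, (∀ i ∈ s, 1 ≤ i ∧ i ≤ d) → ∀ z ∈ wordSpan G v s,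
      G.f i ^ b • G.e i ^ b • z ∈ wordSpan G v s := by
  induction b with
  | zero => simp
  | succ b ih =>
    intro s hs z hz
    obtain ⟨hz1, hz2⟩ := e_smul_mem_wordSpan hv hw h1 h2 hs hz
    rw [pow_succ (G.e i), pow_succ' (G.f i), mul_smul, mul_smul]
    by_cases hi : i ∈ s
    · have := f_smul_mem_wordSpan
        (ih (fun j hj => hs j (Multiset.mem_of_mem_erase hj)) _ hz1) i
      rwa [Multiset.cons_erase hi] at this
    · simp only [hz2 hi, smul_zero, zero_mem]

/-- A subspace stable under the generators is stable under the whole quantum group. -/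
theorem smul_mem_of_generators {P : Submodule KK M}
    (hP : ∀ i, 1 ≤ i → i ≤ d → ∀ x ∈ P,
      G.e i • x ∈ P ∧ G.f i • x ∈ P ∧ G.K i • x ∈ P ∧ G.Kinv i • x ∈ P) (p : G.U) :
    ∀ x ∈ P, p • x ∈ P := by
  induction G.gen p using Algebra.adjoin_induction with
  | mem y hy =>
    obtain ⟨i, h1, h2, rfl | rfl | rfl | rfl⟩ := hy
    · exact fun x hx => (hP i h1 h2 x hx).1
    · exact fun x hx => (hP i h1 h2 x hx).2.1
    · exact fun x hx => (hP i h1 h2 x hx).2.2.1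
    · exact fun x hx => (hP i h1 h2 x hx).2.2.2
  | algebraMap r =>
    intro x hx
    rw [algebraMap_smul]
    exact P.smul_mem r hx
  | add y z _ _ hy hz =>
    intro x hx
    rw [add_smul]
    exact add_mem (hy x hx) (hz x hx)
  | mul y z _ _ hy hz =>
    intro x hx
    rw [mul_smul]
    exact hy _ (hz x hx)

theorem IsHWModule.eq_bot_or_eq_top {lam : ℕ → ℤ} {v : M} (h : IsHWModule G lam v)
    {P : Submodule KK M} (hP : ∀ i, 1 ≤ i → i ≤ d → ∀ x ∈ P,
      G.e i • x ∈ P ∧ G.f i • x ∈ P ∧ G.K i • x ∈ P ∧ G.Kinv i • x ∈ P) : P = ⊥ ∨ P = ⊤ := by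
  let P' : Submodule G.U M :=
    { carrier := P, add_mem' := P.add_mem, zero_mem' := P.zero_mem,
      smul_mem' := fun p x hx => smul_mem_of_generators hP p x hx }
  have hmem : ∀ x, x ∈ P ↔ x ∈ P' := fun x => Iff.rfl
  rcases h.irred P' with h0 | h0
  · left
    ext x
    rw [hmem, h0, Submodule.mem_bot, Submodule.mem_bot]
  · right
    ext x
    simp [hmem, h0]

theorem IsHWModule.span_words {lam : ℕ → ℤ} {v : M} (h : IsHWModule G lam v) :
    Submodule.span KK {x | ∃ is : List ℕ, (∀ i ∈ is, 1 ≤ i ∧ i ≤ d) ∧ x = word G is v} = ⊤ := by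
  set P := Submodule.span KK {x | ∃ is : List ℕ, (∀ i ∈ is, 1 ≤ i ∧ i ≤ d) ∧ x = word G is v}
    with hPdef
  have hle : ∀ s : Multiset ℕ, (∀ i ∈ s, 1 ≤ i ∧ i ≤ d) → wordSpan G v s ≤ P := by
    intro s hs
    refine Submodule.span_mono ?_
    rintro x ⟨is, rfl, rfl⟩
    exact ⟨is, hs, rfl⟩
  have hv : v ∈ P := Submodule.subset_span ⟨[], by simp, rfl⟩
  have hP : ∀ i, 1 ≤ i → i ≤ d → ∀ x ∈ P,
      G.e i • x ∈ P ∧ G.f i • x ∈ P ∧ G.K i • x ∈ P ∧ G.Kinv i • x ∈ P := by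
    intro i h1 h2 x hx
    induction hx using Submodule.span_induction with
    | mem x hx =>
      obtain ⟨is, his, rfl⟩ := hx
      have hK := isWtVec_word h.wt his i h1 h2
      refine ⟨?_, ?_, ?_, ?_⟩
      · exact hle _ (fun j hj => his j (Multiset.mem_of_mem_erase hj))
          (e_smul_word h.wt h.hw h1 h2 his).1
      · exact Submodule.subset_span ⟨i :: is, by simp_all, rfl⟩
      · rw [hK]
        exact P.smul_mem _ (Submodule.subset_span ⟨is, his, rfl⟩)
      · rw [Kinv_smul_of_K_smul h1 h2 hK]
        exact P.smul_mem _ (Submodule.subset_span ⟨is, his, rfl⟩)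
    | zero => simp
    | add x y _ _ hx hy =>
      simp only [smul_add]
      exact ⟨add_mem hx.1 hy.1, add_mem hx.2.1 hy.2.1, add_mem hx.2.2.1 hy.2.2.1,
        add_mem hx.2.2.2 hy.2.2.2⟩
    | smul c x _ hx =>
      simp only [smul_comm _ c]
      exact ⟨P.smul_mem c hx.1, P.smul_mem c hx.2.1, P.smul_mem c hx.2.2.1, P.smul_mem c hx.2.2.2⟩
  refine eq_top_iff.mpr fun w _ => ?_
  obtain ⟨p, rfl⟩ := h.gen w
  exact smul_mem_of_generators hP p v hv

theorem kashSeq_concat (is : List ℕ) (i : ℕ) (v : M) :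
    kashSeq G (is ++ [i]) v = kashF G i (kashSeq G is v) := by
  simp [kashSeq]

theorem isWtVec_kashSeq [FiniteDimensional KK M] {lam : ℕ → ℤ} {v : M} (hv : IsWtVec G v lam)
    (is : List ℕ) (his : ∀ i ∈ is, 1 ≤ i ∧ i ≤ d) :
    IsWtVec G (kashSeq G is v) (letterWt lam is) := by
  induction is using List.reverseRecOn with
  | nil => simpa [kashSeq, letterWt_zero] using hv
  | append_singleton is i ih =>
    have hi := his i (by simp)
    rw [kashSeq_concat]
    have := (ih fun j hj => his j (by simp [hj])).kashF hi.1 hi.2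
    rwa [← letterWt_cons, Multiset.cons_coe,
      Multiset.coe_eq_coe.mpr (List.perm_append_singleton i is).symm] at this

theorem kashF_zero [FiniteDimensional KK M] {i : ℕ} (h1 : 1 ≤ i) (h2 : i ≤ d) :
    kashF G i (0 : M) = 0 := by
  have := kashF_add_smul h1 h2 (IsWtVec.zero (G := G) (M := M) 0) (IsWtVec.zero 0) (-1)
  simpa using this

theorem kashF_mem_kashSpan [FiniteDimensional KK M] {lam : ℕ → ℤ} {v : M} (hv : IsWtVec G v lam)
    {s : Multiset ℕ} (hs : ∀ i ∈ s, 1 ≤ i ∧ i ≤ d) {i : ℕ} (h1 : 1 ≤ i) (h2 : i ≤ d) {z : M}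
    (hz : z ∈ kashSpan G v s) :
    IsWtVec G z (letterWt lam s) ∧ kashF G i z ∈ kashSpan G v (i ::ₘ s) := by
  induction hz using Submodule.span_induction with
  | mem x hx =>
    obtain ⟨is, rfl, rfl⟩ := hx
    refine ⟨isWtVec_kashSeq hv is hs, Submodule.subset_span ⟨is ++ [i], ?_, ?_⟩⟩
    · rw [Multiset.cons_coe, Multiset.coe_eq_coe]
      exact List.perm_append_singleton i is
    · rw [kashSeq_concat]
  | zero => rw [kashF_zero h1 h2]; exact ⟨.zero _, zero_mem _⟩
  | add x y _ _ hx hy =>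
    have := kashF_add_smul h1 h2 hx.1 hy.1 1
    rw [one_smul, one_smul] at this
    rw [this]
    exact ⟨hx.1.add hy.1, add_mem hx.2 hy.2⟩
  | smul c x _ hx =>
    have := kashF_add_smul h1 h2 (.zero _) hx.1 c
    rw [zero_add, kashF_zero h1 h2, zero_add] at this
    rw [this]
    exact ⟨hx.1.smul c, Submodule.smul_mem _ _ hx.2⟩

theorem word_mem_kashSpan [FiniteDimensional KK M] {lam : ℕ → ℤ} {v : M} (hv : IsWtVec G v lam)
    (hw : ∀ i, 1 ≤ i → i ≤ d → G.e i • v = 0) (n : ℕ) :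
    ∀ is : List ℕ, is.length = n → (∀ i ∈ is, 1 ≤ i ∧ i ≤ d) →
      word G is v ∈ kashSpan G v is := by
  induction n with
  | zero =>
    intro is hn _
    rw [List.length_eq_zero_iff.mp hn]
    exact Submodule.subset_span ⟨[], rfl, rfl⟩
  | succ n ih =>
    rintro (_ | ⟨i, is⟩) hn his
    · simp at hn
    have hi := his i List.mem_cons_self
    have his' : ∀ i ∈ is, 1 ≤ i ∧ i ≤ d := fun l hl => his l (List.mem_cons_of_mem i hl)
    have hle : wordSpan G v is ≤ kashSpan G v is := by
      refine Submodule.span_le.mpr ?_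
      rintro x ⟨is', h', rfl⟩
      have hp := Multiset.coe_eq_coe.mp h'
      rw [← h']
      exact ih is' (by rw [hp.length_eq]; simpa using hn) fun j hj => his' j (hp.mem_iff.mp hj)
    have hwt := isWtVec_word hv his'
    obtain ⟨N, hN⟩ := exists_e_pow_smul_eq_zero hi.1 hi.2 (hwt i hi.1 hi.2)
    obtain ⟨w, hw', hsum, hmem⟩ := exists_kashDecomp hi.1 hi.2 (wordSpan G v is)
      (fun b => f_pow_e_pow_smul_mem_wordSpan hv hw hi.1 hi.2 b his') N (word_mem_wordSpan is v)
      hwt hN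
    rw [word_cons, hsum, Finset.smul_sum]
    refine sum_mem fun n _ => ?_
    rw [f_smul_fDiv, ← kashF_fDiv_smul hi.1 hi.2 (hw' n).2 (hw' n).1]
    exact Submodule.smul_mem _ _ (kashF_mem_kashSpan hv his' hi.1 hi.2 (hle (hmem n))).2

theorem IsHWModule.span_latticeGens {lam : ℕ → ℤ} {v : M} (h : IsHWModule G lam v) :
    Submodule.span KK (latticeGens G v) = ⊤ := by
  have := h.findim
  rw [eq_top_iff, ← h.span_words, Submodule.span_le]
  rintro x ⟨is, his, rfl⟩
  refine Submodule.span_le.mpr ?_ (word_mem_kashSpan h.wt h.hw _ is rfl his)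
  rintro x ⟨is', h', rfl⟩
  exact Submodule.subset_span
    ⟨is', fun j hj => his j ((Multiset.coe_eq_coe.mp h').mem_iff.mp hj), rfl⟩

theorem span_eq_top_of_span_A0 {v : M} (h : Submodule.span KK (latticeGens G v) = ⊤) {S : Set M}
    (hS : Submodule.span ↥A0 S = Llat G v) : Submodule.span KK S = ⊤ := by
  rw [eq_top_iff, ← h, Submodule.span_le]
  intro x hx
  have hx' : x ∈ Submodule.span ↥A0 S := hS ▸ Submodule.subset_span hx
  exact Submodule.span_subset_span ↥A0 KK S hx'

end Words

section Forms

variable {M : Type} [AddCommGroup M] [Module KK M] [Module G.U M] [IsScalarTower KK G.U M]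
variable {M' : Type} [AddCommGroup M'] [Module KK M'] [Module G.U M'] [IsScalarTower KK G.U M']

variable {G}

theorem form_eq_zero_of_e_smul {D : M →ₗ[KK] M' →ₗ[KK] KK} {v : M'} {lam : ℕ → ℤ}
    (h : IsHWModule G lam v)
    (he : ∀ i, 1 ≤ i → i ≤ d → ∀ x y, D (G.e i • x) y = D x (G.f i • y)) {x : M}
    (hx : ∀ i, 1 ≤ i → i ≤ d → G.e i • x = 0) (h0 : D x v = 0) : D x = 0 := by
  refine LinearMap.ext_on h.span_words ?_
  rintro y ⟨_ | ⟨i, is⟩, his, rfl⟩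
  · simpa [word] using h0
  · have hi := his i List.mem_cons_self
    rw [word_cons, ← he i hi.1 hi.2, hx i hi.1 hi.2, map_zero, LinearMap.zero_apply,
      LinearMap.zero_apply]

/-- A contravariant pairing of highest weight modules is determined by its value at the
highest weight vectors. -/
theorem form_eq_zero {D : M →ₗ[KK] M' →ₗ[KK] KK} {v : M} {v' : M'} {lam lam' : ℕ → ℤ}
    (h : IsHWModule G lam v) (h' : IsHWModule G lam' v')
    (he : ∀ i, 1 ≤ i → i ≤ d → ∀ x y, D (G.e i • x) y = D x (G.f i • y))
    (hf : ∀ i, 1 ≤ i → i ≤ d → ∀ x y, D (G.f i • x) y = D x (G.e i • y)) (h0 : D v v' = 0) :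
    D = 0 := by
  have hv := form_eq_zero_of_e_smul h' he h.hw h0
  refine LinearMap.ext_on h.span_words ?_
  rintro x ⟨is, his, rfl⟩
  induction is with
  | nil => simpa [word] using hv
  | cons i is ih =>
    have hi := his i List.mem_cons_self
    ext y
    rw [word_cons, hf i hi.1 hi.2, ih fun j hj => his j (List.mem_cons_of_mem i hj)]
    rfl

theorem IsShapovalov.eq_zero {B : M →ₗ[KK] M →ₗ[KK] KK} {v : M} {lam : ℕ → ℤ}
    (hB : IsShapovalov G v B) (h : IsHWModule G lam v) {x : M} (hx : B x = 0) : x = 0 := by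
  obtain ⟨-, hv, he, hf, hK, hKinv⟩ := hB
  have hker : ∀ i, 1 ≤ i → i ≤ d → ∀ y ∈ LinearMap.ker B,
      G.e i • y ∈ LinearMap.ker B ∧ G.f i • y ∈ LinearMap.ker B ∧
        G.K i • y ∈ LinearMap.ker B ∧ G.Kinv i • y ∈ LinearMap.ker B := by
    intro i h1 h2 y hy
    rw [LinearMap.mem_ker] at hy
    refine ⟨?_, ?_, ?_, ?_⟩ <;> rw [LinearMap.mem_ker] <;> ext z
    · rw [he i h1 h2, hy, LinearMap.zero_apply, LinearMap.zero_apply]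
    · rw [hf i h1 h2, hy, LinearMap.zero_apply, LinearMap.zero_apply]
    · rw [hK i h1 h2, hy, LinearMap.zero_apply, LinearMap.zero_apply]
    · rw [hKinv i h1 h2, hy, LinearMap.zero_apply, LinearMap.zero_apply]
  rcases h.eq_bot_or_eq_top hker with h0 | h0
  · exact (Submodule.mem_bot KK).mp (h0 ▸ LinearMap.mem_ker.mpr hx)
  · have : v ∈ LinearMap.ker B := h0 ▸ Submodule.mem_top
    rw [LinearMap.mem_ker.mp this] at hv
    simp at hv

theorem IsShapovalov.apply_eq_zero_of_ne {B : M →ₗ[KK] M →ₗ[KK] KK} {v : M}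
    (hB : IsShapovalov G v B) {i : ℕ} (h1 : 1 ≤ i) (h2 : i ≤ d) {s t : ℤ} (hst : s ≠ t) {x y : M}
    (hx : G.K i • x = qv ^ s • x) (hy : G.K i • y = qv ^ t • y) : B x y = 0 := by
  have h := hB.2.2.2.2.1 i h1 h2 x y
  rw [hx, hy, map_smul, map_smul, LinearMap.smul_apply, smul_eq_mul, smul_eq_mul] at h
  by_contra h0
  exact hst (qv_zpow_injective (mul_right_cancel₀ h0 h))

theorem IsShapovalov.apply_e_pow {B : M →ₗ[KK] M →ₗ[KK] KK} {v : M}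
    (hB : IsShapovalov G v B) {i : ℕ} (h1 : 1 ≤ i) (h2 : i ≤ d) (n : ℕ) (x y : M) :
    B (G.e i ^ n • x) y = qFact n * B x (fDiv G i n • y) := by
  have : B (G.e i ^ n • x) y = B x (G.f i ^ n • y) := by
    induction n generalizing y with
    | zero => simp
    | succ n ih => rw [pow_succ', mul_smul, hB.2.2.1 i h1 h2, ih, ← mul_smul, ← pow_succ]
  rw [this, f_pow_smul_eq, map_smul, smul_eq_mul]

end Forms

section Filtration

variable {M : Type} [AddCommGroup M] [Module KK M] [Module G.U M] [IsScalarTower KK G.U M]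

/-- the span of the words of length less than `n`. -/
def wordFilt (v : M) (n : ℕ) : Submodule KK M :=
  Submodule.span KK
    {x | ∃ is : List ℕ, is.length < n ∧ (∀ i ∈ is, 1 ≤ i ∧ i ≤ d) ∧ x = word G is v}

variable {G}

theorem wordFilt_mono (v : M) : Monotone (wordFilt G v) := by
  intro n n' hn
  refine Submodule.span_mono ?_
  rintro x ⟨is, h, his, rfl⟩
  exact ⟨is, h.trans_le hn, his, rfl⟩

theorem wordFilt_zero (v : M) : wordFilt G v 0 = ⊥ := by simp [wordFilt]

theorem e_smul_mem_wordFilt {v : M} {lam : ℕ → ℤ} (h : IsHWModule G lam v) {i : ℕ} (h1 : 1 ≤ i)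
    (h2 : i ≤ d) {n : ℕ} {x : M} (hx : x ∈ wordFilt G v (n + 1)) :
    G.e i • x ∈ wordFilt G v n := by
  induction hx using Submodule.span_induction with
  | mem x hx =>
    obtain ⟨is, hn, his, rfl⟩ := hx
    obtain ⟨hm, h0⟩ := e_smul_word h.wt h.hw h1 h2 his
    by_cases hi : i ∈ is
    · refine Submodule.span_mono ?_ hm
      rintro y ⟨is', hp, rfl⟩
      refine ⟨is', ?_, fun j hj => ?_, rfl⟩
      · have := congrArg Multiset.card hp
        rw [Multiset.coe_card, Multiset.card_erase_of_mem (Multiset.mem_coe.mpr hi),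
          Multiset.coe_card, Nat.pred_eq_sub_one] at this
        have := List.length_pos_of_mem hi
        omega
      · rw [← Multiset.mem_coe, hp] at hj
        exact his j (Multiset.mem_of_mem_erase hj)
    · rw [h0 hi]
      exact zero_mem _
  | zero => rw [smul_zero]; exact zero_mem _
  | add x y _ _ hx hy => rw [smul_add]; exact add_mem hx hy
  | smul c x _ hx => rw [smul_comm]; exact Submodule.smul_mem _ _ hx

theorem exists_mem_wordFilt {v : M} {lam : ℕ → ℤ} (h : IsHWModule G lam v) (x : M) :
    ∃ n, x ∈ wordFilt G v n := by
  have hx : x ∈ Submodule.span KK _ := h.span_words ▸ Submodule.mem_top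
  induction hx using Submodule.span_induction with
  | mem x hx =>
    obtain ⟨is, his, rfl⟩ := hx
    exact ⟨is.length + 1, Submodule.subset_span ⟨is, lt_add_one _, his, rfl⟩⟩
  | zero => exact ⟨0, zero_mem _⟩
  | add x y _ _ hx hy =>
    obtain ⟨n, hn⟩ := hx
    obtain ⟨n', hn'⟩ := hy
    exact ⟨max n n', add_mem (wordFilt_mono v (le_max_left _ _) hn)
      (wordFilt_mono v (le_max_right _ _) hn')⟩
  | smul c x _ hx =>
    obtain ⟨n, hn⟩ := hx
    exact ⟨n, Submodule.smul_mem _ _ hn⟩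

theorem IsHWModule.exists_e_pow_smul_eq_zero {v : M} {lam : ℕ → ℤ} (h : IsHWModule G lam v)
    {i : ℕ} (h1 : 1 ≤ i) (h2 : i ≤ d) (x : M) : ∃ n : ℕ, G.e i ^ (n + 1) • x = 0 := by
  obtain ⟨n, hn⟩ := exists_mem_wordFilt h x
  suffices hpow : G.e i ^ n • x = 0 from ⟨n, by rw [pow_succ', mul_smul, hpow, smul_zero]⟩
  induction n generalizing x with
  | zero => simpa [wordFilt_zero] using hn
  | succ n ih => rw [pow_succ, mul_smul, ih _ (e_smul_mem_wordFilt h h1 h2 hn)]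

/-- A nonzero subspace stable under some of the `e_i` has a nonzero vector they annihilate. -/
theorem exists_e_smul_eq_zero {v : M} {lam : ℕ → ℤ} (h : IsHWModule G lam v)
    {P : Submodule KK M} (hP0 : P ≠ ⊥) {d' : ℕ} (hd : d' ≤ d)
    (hP : ∀ i, 1 ≤ i → i ≤ d' → ∀ x ∈ P, G.e i • x ∈ P) :
    ∃ w ∈ P, w ≠ 0 ∧ ∀ i, 1 ≤ i → i ≤ d' → G.e i • w = 0 := by
  have hex : ∃ n, ∃ w ∈ P, w ≠ 0 ∧ w ∈ wordFilt G v n := by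
    obtain ⟨w, hw, hw0⟩ := P.ne_bot_iff.mp hP0
    obtain ⟨n, hn⟩ := exists_mem_wordFilt h w
    exact ⟨n, w, hw, hw0, hn⟩
  obtain ⟨w, hw, hw0, hn⟩ := Nat.find_spec hex
  have hmin := fun m => Nat.find_min hex (m := m)
  generalize Nat.find hex = n at hn hmin
  refine ⟨w, hw, hw0, fun i h1 h2 => ?_⟩
  cases n with
  | zero => simp [wordFilt_zero, hw0] at hn
  | succ n =>
    by_contra hne
    exact hmin n n.lt_succ_self
      ⟨_, hP i h1 h2 w hw, hne, e_smul_mem_wordFilt h h1 (h2.trans hd) hn⟩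

end Filtration

section RankTwo

variable {U : Type} [Ring U] [Algebra KK U] {M : Type} [AddCommGroup M] [Module KK M] [Module U M]
  [IsScalarTower KK U M]

theorem qIntZ_step (n : ℤ) : qv * qIntZ n + qv ^ (-n) = qIntZ (n + 1) := by
  have h := qv_sub_inv_ne_zero
  rw [qIntZ, qIntZ, ← mul_div_assoc, div_add' _ _ _ h]
  congr 1
  have hq := qv_ne_zero
  rw [neg_add, zpow_add₀ hq, zpow_add₀ hq, zpow_neg_one, zpow_one]
  ring

variable {a b : U}

theorem serre_left
    (hab : a * a * b - (qv + qv⁻¹) • (a * b * a) + b * a * a = 0) :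
    a * (a * b - qv⁻¹ • (b * a)) = qv • ((a * b - qv⁻¹ • (b * a)) * a) := by
  rw [add_smul] at hab
  simp only [mul_sub, sub_mul, mul_smul_comm, smul_mul_assoc, smul_sub, smul_smul,
    mul_inv_cancel₀ qv_ne_zero, one_smul, mul_assoc] at hab ⊢
  rw [← sub_eq_zero, ← hab]
  abel

theorem serre_right
    (hba : b * b * a - (qv + qv⁻¹) • (b * a * b) + a * b * b = 0) :
    b * (a * b - qv⁻¹ • (b * a)) = qv⁻¹ • ((a * b - qv⁻¹ • (b * a)) * b) := by
  have h := congrArg (qv⁻¹ • ·) hba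
  simp only [add_smul, mul_sub, sub_mul, mul_smul_comm, smul_mul_assoc, smul_sub, smul_smul,
    smul_add,
    inv_mul_cancel₀ qv_ne_zero, one_smul, mul_assoc, smul_zero] at h ⊢
  rw [← sub_eq_zero, ← neg_eq_zero, ← h]
  abel

theorem smul_pow_serre
    (hba : b * b * a - (qv + qv⁻¹) • (b * a * b) + a * b * b = 0) (n : ℕ) (x : M) :
    b ^ n • (a * b - qv⁻¹ • (b * a)) • x = qv⁻¹ ^ n • (a * b - qv⁻¹ • (b * a)) • b ^ n • x := by
  induction n with
  | zero => simp
  | succ n ih =>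
    rw [pow_succ', mul_smul, ih, smul_comm b (_ : KK), ← mul_smul b, serre_right hba, smul_assoc,
      mul_smul _ b, pow_succ qv⁻¹, smul_smul, mul_smul b]

theorem smul_pow_smul_of_smul_eq_zero
    (hab : a * a * b - (qv + qv⁻¹) • (a * b * a) + b * a * a = 0) {y : M} (hy : b • y = 0)
    (n : ℕ) : b • a ^ (n + 1) • y =
      -(qv ^ (n + 1) * qInt (n + 1)) • (a * b - qv⁻¹ • (b * a)) • a ^ n • y := by
  have key : ∀ x : M, b • a • x = qv • a • b • x - qv • (a * b - qv⁻¹ • (b * a)) • x := by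
    intro x
    rw [sub_smul, smul_sub, smul_assoc, smul_smul qv, mul_inv_cancel₀ qv_ne_zero, one_smul,
      mul_smul, mul_smul, sub_sub_cancel]
  have hE : ∀ x : M, a • (a * b - qv⁻¹ • (b * a)) • x = qv • (a * b - qv⁻¹ • (b * a)) • a • x := by
    intro x
    rw [← mul_smul a, serre_left hab, smul_assoc, mul_smul]
  induction n with
  | zero => simp [key, hy, qInt_eq, qIntZ_one]
  | succ n ih =>
    rw [pow_succ', mul_smul, key, ih, smul_comm a (_ : KK), hE, ← mul_smul a, ← pow_succ',
      smul_smul,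
      smul_smul, ← sub_smul]
    congr 1
    have h := qIntZ_step (n + 1)
    rw [qInt_eq, qInt_eq]
    push_cast
    rw [← h, zpow_neg, mul_add, pow_succ qv (n + 1)]
    have : qv ^ (n + 1) * (qv ^ ((n : ℤ) + 1))⁻¹ = 1 := by
      rw [← Nat.cast_succ, zpow_natCast]
      exact mul_inv_cancel₀ (pow_ne_zero _ qv_ne_zero)
    linear_combination qv * this

theorem pow_smul_pow_smul
    (hab : a * a * b - (qv + qv⁻¹) • (a * b * a) + b * a * a = 0)
    (hba : b * b * a - (qv + qv⁻¹) • (b * a * b) + a * b * b = 0) {y : M} (hy : b • y = 0)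
    (n c : ℕ) : ∃ κ : KK, κ ≠ 0 ∧ b ^ (c + 1) • a ^ (n + 1) • y =
      κ • (a * b - qv⁻¹ • (b * a)) • b ^ c • a ^ n • y := by
  refine ⟨-(qv ^ (n + 1) * qInt (n + 1)) * qv⁻¹ ^ c, ?_, ?_⟩
  · exact mul_ne_zero (neg_ne_zero.mpr (mul_ne_zero (pow_ne_zero _ qv_ne_zero)
      (qInt_succ_ne_zero n))) (pow_ne_zero _ (inv_ne_zero qv_ne_zero))
  · rw [pow_succ, mul_smul, smul_pow_smul_of_smul_eq_zero hab hy, smul_comm (b ^ c) (_ : KK),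
      smul_pow_serre hba, smul_smul]

theorem pow_smul_pow_smul_eq_zero
    (hab : a * a * b - (qv + qv⁻¹) • (a * b * a) + b * a * a = 0)
    (hba : b * b * a - (qv + qv⁻¹) • (b * a * b) + a * b * b = 0) {y : M} (hy : b • y = 0)
    (n : ℕ) : b ^ (n + 1) • a ^ n • y = 0 := by
  induction n with
  | zero => simpa using hy
  | succ n ih =>
    obtain ⟨κ, -, h⟩ := pow_smul_pow_smul hab hba hy n (n + 1)
    rw [h, ih, smul_zero, smul_zero]

theorem smul_pow_smul_pow_smul
    (hab : a * a * b - (qv + qv⁻¹) • (a * b * a) + b * a * a = 0)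
    (hba : b * b * a - (qv + qv⁻¹) • (b * a * b) + a * b * b = 0) {y : M} (hy : b • y = 0)
    (n c : ℕ) : ∃ κ : KK, a • b ^ c • a ^ n • y = κ • b ^ c • a ^ (n + 1) • y := by
  induction n generalizing c with
  | zero =>
    cases c with
    | zero => exact ⟨1, by simp⟩
    | succ c => exact ⟨0, by rw [pow_zero, one_smul, pow_succ, mul_smul, hy]; simp⟩
  | succ n ih =>
    cases c with
    | zero =>
      exact ⟨1, by rw [pow_zero, one_smul, one_smul, one_smul, pow_succ' a (n + 1), mul_smul]⟩
    | succ c =>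
      obtain ⟨κ₁, -, h₁⟩ := pow_smul_pow_smul hab hba hy n c
      obtain ⟨κ₂, hκ₂, h₂⟩ := pow_smul_pow_smul hab hba hy (n + 1) c
      obtain ⟨κ₃, h₃⟩ := ih c
      refine ⟨κ₁ * qv * κ₃ * κ₂⁻¹, ?_⟩
      rw [h₁, h₂, smul_comm a (_ : KK), ← mul_smul a, serre_left hab, smul_assoc, mul_smul _ a, h₃,
        smul_comm _ κ₃, smul_smul κ₁, smul_smul, smul_smul _ κ₂, inv_mul_cancel_right₀ hκ₂]

theorem smul_pow_smul_pow_smul_eq_zero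
    (hab : a * a * b - (qv + qv⁻¹) • (a * b * a) + b * a * a = 0)
    (hba : b * b * a - (qv + qv⁻¹) • (b * a * b) + a * b * b = 0) {y : M} (hy : b • y = 0)
    {n : ℕ} (hn : a ^ (n + 1) • y = 0) (c : ℕ) : a • b ^ c • a ^ n • y = 0 := by
  obtain ⟨κ, h⟩ := smul_pow_smul_pow_smul hab hba hy n c
  rw [h, hn, smul_zero, smul_zero]

end RankTwo

section Chain

variable {M : Type} [AddCommGroup M] [Module KK M] [Module G.U M] [IsScalarTower KK G.U M]

/-- `f_{a+r-1}^{(j)} ⋯ f_a^{(j)} v`. -/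
def chainVec (a j : ℕ) (v : M) (r : ℕ) : M :=
  (List.range r).foldl (fun x s => fDiv G (a + s) j • x) v

theorem fDivChain_const (a a' j : ℕ) (v : M) :
    fDivChain G (fun _ => j) a a' v = chainVec G a j v (a' + 1 - a) := rfl

theorem chainVec_zero (a j : ℕ) (v : M) : chainVec G a j v 0 = v := rfl

theorem chainVec_succ (a j : ℕ) (v : M) (r : ℕ) :
    chainVec G a j v (r + 1) = fDiv G (a + r) j • chainVec G a j v r := by
  simp [chainVec, List.range_succ]

/-- the weight of `chainVec` applied to a vector of weight `lam`. -/
def chainWt (lam : ℕ → ℤ) (a j r : ℕ) : ℕ → ℤ :=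
  fun t => lam t - ∑ s ∈ Finset.range r, (j : ℤ) * cartan t (a + s)

variable {G}

theorem isWtVec_chainVec {lam : ℕ → ℤ} {v : M} (hv : IsWtVec G v lam) {a : ℕ} (ha : 1 ≤ a) (j : ℕ)
    {r : ℕ} (hr : a + r ≤ d + 1) : IsWtVec G (chainVec G a j v r) (chainWt lam a j r) := by
  induction r with
  | zero =>
    convert hv using 1
    · rw [chainVec_zero]
    · funext t
      simp [chainWt]
  | succ r ih =>
    rw [chainVec_succ]
    convert (ih (by omega)).fDiv (j := a + r) (by omega) (by omega) j using 1
    funext t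
    rw [chainWt, chainWt, Finset.sum_range_succ]
    ring

theorem e_smul_fDiv_of_ne {i j : ℕ} (h1 : 1 ≤ i) (h2 : i ≤ d) (h3 : 1 ≤ j) (h4 : j ≤ d)
    (hij : i ≠ j) (n : ℕ) (x : M) : G.e i • fDiv G j n • x = fDiv G j n • G.e i • x := by
  have : G.e i • G.f j ^ n • x = G.f j ^ n • G.e i • x := by
    induction n with
    | zero => simp
    | succ n ih => rw [pow_succ', mul_smul, e_f_smul_of_ne h1 h2 h3 h4 hij, ih, ← mul_smul (G.f j)]
  rw [fDiv_smul, fDiv_smul, smul_comm (G.e i) (_ : KK), this]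

theorem e_smul_chainVec {v : M} (hw : ∀ i, 1 ≤ i → i ≤ d → G.e i • v = 0) {a : ℕ} (ha : 1 ≤ a)
    (j : ℕ) {r i : ℕ} (hi : a + r ≤ i) (h2 : i ≤ d) : G.e i • chainVec G a j v r = 0 := by
  induction r with
  | zero => exact hw i (by omega) h2
  | succ r ih =>
    rw [chainVec_succ, e_smul_fDiv_of_ne (by omega) h2 (by omega) (by omega) (by omega),
      ih (by omega), smul_zero]

theorem chainWt_apply_succ (a m j r : ℕ) : chainWt (omWt a m) a j (r + 1) (a + (r + 1)) = j := by
  rw [chainWt, Finset.sum_range_succ, Finset.sum_eq_zero, omWt, if_neg (by omega), cartan,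
    if_neg (by omega), if_pos (by omega)]
  · ring
  · intro s hs
    have := Finset.mem_range.mp hs
    rw [cartan, if_neg (by omega), if_neg (by omega), mul_zero]

theorem kashSeq_append (l l' : List ℕ) (v : M) :
    kashSeq G (l ++ l') v = kashSeq G l' (kashSeq G l v) := List.foldl_append

theorem kashSeq_replicate [FiniteDimensional KK M] {i : ℕ} (h1 : 1 ≤ i) (h2 : i ≤ d)
    {μ : ℕ → ℤ} {x : M} (hx : IsWtVec G x μ) (he : G.e i • x = 0) (n : ℕ) :
    kashSeq G (List.replicate n i) x = fDiv G i n • x := by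
  induction n with
  | zero => simp [kashSeq, fDiv_zero_smul]
  | succ n ih => rw [List.replicate_succ', kashSeq_concat, ih, kashF_fDiv_smul h1 h2 hx he]

theorem exists_kashSeq_eq_chainVec [FiniteDimensional KK M] {lam : ℕ → ℤ} {v : M}
    (hv : IsWtVec G v lam) (hw : ∀ i, 1 ≤ i → i ≤ d → G.e i • v = 0) {a : ℕ} (ha : 1 ≤ a) (j : ℕ)
    {r : ℕ} (hr : a + r ≤ d + 1) :
    ∃ is : List ℕ, (∀ i ∈ is, 1 ≤ i ∧ i ≤ d) ∧ chainVec G a j v r = kashSeq G is v := by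
  induction r with
  | zero => exact ⟨[], by simp, rfl⟩
  | succ r ih =>
    obtain ⟨is, his, h⟩ := ih (by omega)
    refine ⟨is ++ List.replicate j (a + r), fun i hi => ?_, ?_⟩
    · rcases List.mem_append.mp hi with hi | hi
      · exact his i hi
      · rw [List.eq_of_mem_replicate hi]
        omega
    · rw [chainVec_succ, kashSeq_append, ← h,
        kashSeq_replicate (by omega) (by omega) (isWtVec_chainVec hv ha j (by omega))
          (e_smul_chainVec hw ha j le_rfl (by omega))]

theorem chainVec_mem_latticeGens [FiniteDimensional KK M] {lam : ℕ → ℤ} {v : M}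
    (hv : IsWtVec G v lam) (hw : ∀ i, 1 ≤ i → i ≤ d → G.e i • v = 0) {a : ℕ} (ha : 1 ≤ a) (j : ℕ)
    {r : ℕ} (hr : a + r ≤ d + 1) : chainVec G a j v r ∈ latticeGens G v :=
  exists_kashSeq_eq_chainVec hv hw ha j hr

theorem exists_UAring_smul_eq_chainVec (v : M) {a : ℕ} (ha : 1 ≤ a) (j : ℕ)
    {r : ℕ} (hr : a + r ≤ d + 1) : ∃ p ∈ UAring G, chainVec G a j v r = p • v := by
  induction r with
  | zero => exact ⟨1, one_mem _, by rw [chainVec_zero, one_smul]⟩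
  | succ r ih =>
    obtain ⟨p, hp, h⟩ := ih (by omega)
    refine ⟨fDiv G (a + r) j * p, mul_mem (Subring.subset_closure ?_) hp, ?_⟩
    · exact Or.inl (Or.inr ⟨a + r, j, by omega, by omega, Or.inr rfl⟩)
    · rw [chainVec_succ, h, ← mul_smul]

end Chain

section Branching

variable {M : Type} [AddCommGroup M] [Module KK M] [Module G.U M] [IsScalarTower KK G.U M]

/-- the largest `n` with `e_iⁿ x ≠ 0`, for `x ≠ 0`. -/
def topPow (i : ℕ) (x : M) : ℕ := sInf {n | G.e i ^ (n + 1) • x = 0}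

/-- The vectors `e_{d-s+1}^{max} ⋯ e_{d-1}^{max} e_d^{max} w`. -/
def raise (w : M) : ℕ → M
  | 0 => w
  | s + 1 => G.e (d - s) ^ topPow G (d - s) (raise w s) • raise w s

/-- The exponents occurring in `raise`. -/
def raiseExp (w : M) (s : ℕ) : ℕ := topPow G (d - s) (raise G w s)

theorem raise_succ (w : M) (s : ℕ) :
    raise G w (s + 1) = G.e (d - s) ^ raiseExp G w s • raise G w s := rfl

/-- The vectors obtained from `v` by applying the divided powers with the exponents of `raise` in
the opposite order. -/
def lowerVec (w v : M) : ℕ → M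
  | 0 => v
  | t + 1 => fDiv G (t + 1) (raiseExp G w (d - (t + 1))) • lowerVec w v t

variable {G}

theorem e_pow_topPow_ne_zero {i : ℕ} {x : M} (hx : x ≠ 0) : G.e i ^ topPow G i x • x ≠ 0 := by
  generalize h : topPow G i x = n
  cases n with
  | zero => simpa using hx
  | succ n => exact fun h0 => Nat.notMem_of_lt_sInf (n.lt_succ_self.trans_eq h.symm) h0

theorem e_pow_topPow_succ {v : M} {lam : ℕ → ℤ} (h : IsHWModule G lam v)
    {i : ℕ} (h1 : 1 ≤ i) (h2 : i ≤ d) (x : M) : G.e i ^ (topPow G i x + 1) • x = 0 :=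
  Nat.sInf_mem (s := {n | G.e i ^ (n + 1) • x = 0}) (h.exists_e_pow_smul_eq_zero h1 h2 x)

theorem topPow_le {i n : ℕ} {x : M} (h : G.e i ^ (n + 1) • x = 0) : topPow G i x ≤ n :=
  Nat.sInf_le h

theorem raise_ne_zero {w : M} (hw : w ≠ 0) : ∀ s, raise G w s ≠ 0
  | 0 => hw
  | s + 1 => e_pow_topPow_ne_zero (raise_ne_zero hw s)

theorem e_smul_e_pow_of_far {i j : ℕ} (h1 : 1 ≤ i) (h2 : i ≤ d) (h3 : 1 ≤ j) (h4 : j ≤ d)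
    (hij : i + 1 < j ∨ j + 1 < i) (n : ℕ) (x : M) :
    G.e i • G.e j ^ n • x = G.e j ^ n • G.e i • x := by
  rw [← mul_smul, ← mul_smul, (Commute.pow_right (G.comm_e i j h1 h2 h3 h4 hij) n).eq]

theorem e_smul_raise {v w : M} {lam : ℕ → ℤ} (h : IsHWModule G lam v)
    (he : ∀ i, 1 ≤ i → i + 1 ≤ d → G.e i • w = 0) {s : ℕ} (hs : s ≤ d) :
    ∀ i, 1 ≤ i → i ≤ d → i ≠ d - s → G.e i • raise G w s = 0 := by
  induction s using Nat.strong_induction_on with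
  | _ s ih =>
    intro i h1 h2 h3
    rcases s with _ | s
    · exact he i h1 (by omega)
    have hs0 := ih s (by omega) (by omega)
    by_cases hi : i = d - s
    · rw [hi, raise_succ, ← mul_smul, ← pow_succ']
      exact e_pow_topPow_succ h (by omega) (by omega) _
    by_cases hfar : i + 1 < d - s ∨ d - s + 1 < i
    · rw [raise_succ, e_smul_e_pow_of_far h1 h2 (by omega) (by omega) hfar, hs0 i h1 h2 hi,
        smul_zero]
    rcases s with _ | s
    · omega
    obtain rfl : i = d - s := by omega
    rw [raise_succ, raise_succ]
    exact smul_pow_smul_pow_smul_eq_zero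
      (G.serre_e (d - s) (d - (s + 1)) h1 h2 (by omega) (by omega) (by omega))
      (G.serre_e (d - (s + 1)) (d - s) (by omega) (by omega) h1 h2 (by omega))
      (ih s (by omega) (by omega) (d - (s + 1)) (by omega) (by omega) (by omega))
      (e_pow_topPow_succ h h1 h2 _) _

theorem raiseExp_succ_le {v w : M} {lam : ℕ → ℤ} (h : IsHWModule G lam v)
    (he : ∀ i, 1 ≤ i → i + 1 ≤ d → G.e i • w = 0) {s : ℕ} (hs : s + 1 < d) :
    raiseExp G w (s + 1) ≤ raiseExp G w s := by
  refine topPow_le ?_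
  rw [raise_succ]
  exact pow_smul_pow_smul_eq_zero
    (G.serre_e (d - s) (d - (s + 1)) (by omega) (by omega) (by omega) (by omega) (by omega))
    (G.serre_e (d - (s + 1)) (d - s) (by omega) (by omega) (by omega) (by omega) (by omega))
    (e_smul_raise h he (by omega) (d - (s + 1)) (by omega) (by omega) (by omega)) _

theorem apply_raise_lowerVec_ne_zero {B : M →ₗ[KK] M →ₗ[KK] KK} {v w : M} {lam : ℕ → ℤ}
    (hB : IsShapovalov G v B) (h : IsHWModule G lam v)
    (he : ∀ i, 1 ≤ i → i + 1 ≤ d → G.e i • w = 0) (hw : w ≠ 0) {t : ℕ} (ht : t ≤ d) :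
    B (raise G w (d - t)) (lowerVec G w v t) ≠ 0 := by
  induction t with
  | zero =>
    intro h0
    refine raise_ne_zero (G := G) hw d (hB.eq_zero h (form_eq_zero_of_e_smul h hB.2.2.1 ?_ h0))
    exact fun i h1 h2 => e_smul_raise h he le_rfl i h1 h2 (by omega)
  | succ t ih =>
    specialize ih (by omega)
    obtain ⟨s, hs, hs'⟩ : ∃ s, d - t = s + 1 ∧ d - (t + 1) = s := ⟨d - (t + 1), by omega, rfl⟩
    have hds : d - s = t + 1 := by omega
    rw [hs, raise_succ, hds, hB.apply_e_pow (by omega) ht] at ih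
    rw [lowerVec, hs']
    exact right_ne_zero_of_mul ih

theorem lowerVec_eq_self {B : M →ₗ[KK] M →ₗ[KK] KK} {v w : M} {a m : ℕ}
    (hB : IsShapovalov G v B) (h : IsHWModule G (omWt a m) v)
    (he : ∀ i, 1 ≤ i → i + 1 ≤ d → G.e i • w = 0) (hw : w ≠ 0) {t : ℕ} (ht : t < a) (hta : t ≤ d) :
    lowerVec G w v t = v := by
  have := h.findim
  induction t with
  | zero => rfl
  | succ t ih =>
    have hne : lowerVec G w v (t + 1) ≠ 0 := fun h0 =>
      apply_raise_lowerVec_ne_zero hB h he hw hta (by rw [h0, map_zero])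
    have hK := h.wt (t + 1) (by omega) hta
    rw [omWt, if_neg (by omega)] at hK
    rw [lowerVec, ih (by omega) (by omega)] at hne ⊢
    by_cases hn : raiseExp G w (d - (t + 1)) = 0
    · rw [hn, fDiv_zero_smul]
    · exact absurd (fDiv_eq_zero_of_lt (by omega) hta hK (h.hw _ (by omega) hta) (by omega)) hne

theorem lowerVec_eq_chainVec {B : M →ₗ[KK] M →ₗ[KK] KK} {v w : M} {a m : ℕ} (ha : 1 ≤ a)
    (hB : IsShapovalov G v B) (h : IsHWModule G (omWt a m) v)
    (he : ∀ i, 1 ≤ i → i + 1 ≤ d → G.e i • w = 0) (hw : w ≠ 0) {r : ℕ} (hr : a + r ≤ d) :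
    raiseExp G w (d - (a + r)) = raiseExp G w (d - a) ∧ raiseExp G w (d - a) ≤ m ∧
      lowerVec G w v (a + r) = chainVec G a (raiseExp G w (d - a)) v (r + 1) := by
  have := h.findim
  have hne : ∀ t ≤ d, lowerVec G w v t ≠ 0 := fun t ht h0 =>
    apply_raise_lowerVec_ne_zero hB h he hw ht (by rw [h0, map_zero])
  induction r with
  | zero =>
    obtain ⟨b, rfl⟩ : ∃ b, a = b + 1 := ⟨a - 1, by omega⟩
    have hv := lowerVec_eq_self hB h he hw (t := b) (by omega) (by omega)
    have hz := hne (b + 1) hr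
    rw [lowerVec, hv] at hz
    refine ⟨rfl, ?_, ?_⟩
    · by_contra! hlt
      have hK := h.wt (b + 1) ha hr
      rw [omWt, if_pos rfl] at hK
      exact hz (fDiv_eq_zero_of_lt ha hr hK (h.hw _ ha hr) (by exact_mod_cast hlt))
    · rw [add_zero, lowerVec, hv, chainVec_succ, chainVec_zero, add_zero]
  | succ r ih =>
    obtain ⟨ih1, ih2, ih3⟩ := ih (by omega)
    have hz := hne (a + (r + 1)) hr
    rw [← add_assoc, lowerVec, ih3] at hz ⊢
    rw [add_assoc a r 1] at hz ⊢
    have hge : raiseExp G w (d - a) ≤ raiseExp G w (d - (a + (r + 1))) := by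
      have := raiseExp_succ_le h he (s := d - (a + (r + 1))) (by omega)
      rwa [show d - (a + (r + 1)) + 1 = d - (a + r) by omega, ih1] at this
    have hle : raiseExp G w (d - (a + (r + 1))) ≤ raiseExp G w (d - a) := by
      by_contra! hlt
      have hK := isWtVec_chainVec h.wt ha (raiseExp G w (d - a)) (r := r + 1) (by omega)
        (a + (r + 1)) (by omega) hr
      rw [chainWt_apply_succ] at hK
      exact hz (fDiv_eq_zero_of_lt (by omega) hr hK
        (e_smul_chainVec h.hw ha _ le_rfl hr) (by exact_mod_cast hlt))
    have heq := le_antisymm hle hge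
    refine ⟨heq, ih2, ?_⟩
    rw [chainVec_succ G a _ v (r + 1), heq]

/-- A subspace stable under `e_1, …, e_{d-1}` and orthogonal to the highest weight vectors
`f_d^{(j)} ⋯ f_a^{(j)} v` vanishes. -/
theorem eq_bot_of_apply_chainVec_eq_zero {B : M →ₗ[KK] M →ₗ[KK] KK} {v : M} {a m : ℕ}
    (ha : 1 ≤ a) (had : a ≤ d) (hB : IsShapovalov G v B) (h : IsHWModule G (omWt a m) v)
    {P : Submodule KK M} (hP : ∀ i, 1 ≤ i → i ≤ d - 1 → ∀ x ∈ P, G.e i • x ∈ P)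
    (h0 : ∀ j ≤ m, ∀ x ∈ P, B x (fDivChain G (fun _ => j) a d v) = 0) : P = ⊥ := by
  by_contra hne
  obtain ⟨w, hwP, hw, he⟩ := exists_e_smul_eq_zero h hne (Nat.sub_le d 1) hP
  have he' : ∀ i, 1 ≤ i → i + 1 ≤ d → G.e i • w = 0 := fun i h1 h2 => he i h1 (by omega)
  obtain ⟨r, rfl⟩ := Nat.exists_eq_add_of_le had
  obtain ⟨-, hm, hl⟩ := lowerVec_eq_chainVec ha hB h he' hw (r := r) le_rfl
  have := apply_raise_lowerVec_ne_zero hB h he' hw (t := a + r) le_rfl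
  rw [Nat.sub_self, hl] at this
  refine this ?_
  have h0' := h0 _ hm w hwP
  rwa [fDivChain_const, show a + r + 1 - a = r + 1 by omega] at h0'

end Branching

section Scalars

theorem mem_A0_iff {x : KK} : x ∈ A0 ↔ (RatFunc.denom x).eval 0 ≠ 0 := Iff.rfl

/-- A rational constant in `q A₀` vanishes. -/
theorem eq_zero_of_mem_qv_mul_A0 {c : ℚ} {a : KK} (ha : a ∈ A0)
    (h : algebraMap ℚ KK c = qv * a) : c = 0 := by
  have hden : algebraMap (Polynomial ℚ) KK a.denom ≠ 0 :=
    RatFunc.algebraMap_ne_zero a.denom_ne_zero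
  have h1 : algebraMap (Polynomial ℚ) KK (Polynomial.C c * a.denom) =
      algebraMap (Polynomial ℚ) KK (Polynomial.X * a.num) := by
    have hC : algebraMap (Polynomial ℚ) KK (Polynomial.C c) = algebraMap ℚ KK c :=
      RingHom.congr_fun
        (Subsingleton.elim ((algebraMap _ KK).comp Polynomial.C) (algebraMap ℚ KK)) c
    have hnum : a * algebraMap (Polynomial ℚ) KK a.denom = algebraMap (Polynomial ℚ) KK a.num :=
      ((div_eq_iff hden).mp (RatFunc.num_div_denom a)).symm
    rw [map_mul, map_mul, hC, h, RatFunc.algebraMap_X, mul_assoc, hnum, qv]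
  have h2 := congrArg (Polynomial.eval 0) (RatFunc.algebraMap_injective ℚ h1)
  simpa [mem_A0_iff.mp ha] using h2

theorem IsBarK.map_qInt {barK : KK →+* KK} (h : IsBarK barK) (n : ℕ) :
    barK (qInt n) = qInt n := by
  rw [qInt, map_div₀, map_sub, map_sub, map_pow, map_pow, map_inv₀, h.1, inv_inv,
    ← neg_sub (qv ^ n), ← neg_sub qv, neg_div_neg_eq]

theorem IsBarK.map_qFact {barK : KK →+* KK} (h : IsBarK barK) (n : ℕ) :
    barK (qFact n) = qFact n := by
  induction n with
  | zero => exact map_one barK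
  | succ n ih => rw [qFact, map_mul, ih, h.map_qInt]

end Scalars

section Psi

variable {M : Type} [AddCommGroup M] [Module KK M] [Module G.U M] [IsScalarTower KK G.U M]

variable {G}

theorem IsPsi.map_fDiv_smul {barK : KK →+* KK} (hbar : IsBarK barK) {v : M} {psi : M →+ M}
    (h : IsPsi G v barK psi) {i : ℕ} (h1 : 1 ≤ i) (h2 : i ≤ d) (n : ℕ) (x : M) :
    psi (fDiv G i n • x) = fDiv G i n • psi x := by
  have : psi (G.f i ^ n • x) = G.f i ^ n • psi x := by
    induction n with
    | zero => simp
    | succ n ih => rw [pow_succ', mul_smul, mul_smul, h.2.2.2.1 i h1 h2, ih]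
  rw [fDiv_smul, fDiv_smul, h.2.1, map_inv₀, hbar.map_qFact, this]

theorem IsPsi.map_word {barK : KK →+* KK} {v : M} {psi : M →+ M}
    (h : IsPsi G v barK psi) {is : List ℕ} (his : ∀ i ∈ is, 1 ≤ i ∧ i ≤ d) (x : M) :
    psi (word G is x) = word G is (psi x) := by
  induction is with
  | nil => rfl
  | cons i is ih =>
    have hi := his i List.mem_cons_self
    rw [word_cons, word_cons, h.2.2.2.1 i hi.1 hi.2,
      ih fun j hj => his j (List.mem_cons_of_mem i hj)]

theorem IsPsi.map_chainVec {barK : KK →+* KK} (hbar : IsBarK barK) {v : M} {psi : M →+ M}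
    (h : IsPsi G v barK psi) {a : ℕ} (ha : 1 ≤ a) (j : ℕ) {r : ℕ} (hr : a + r ≤ d + 1) :
    psi (chainVec G a j v r) = chainVec G a j v r := by
  induction r with
  | zero => exact h.1
  | succ r ih =>
    rw [chainVec_succ, h.map_fDiv_smul hbar (by omega) (by omega), ih (by omega)]

end Psi

section Dual

variable {M : Type} [AddCommGroup M] [Module KK M]

theorem eq_zero_of_dual {S : Set M} {ℓ : M → M →ₗ[KK] KK}
    (hℓ : ∀ g ∈ S, ∀ g' ∈ S, ℓ g g' = if g = g' then 1 else 0) {x : M}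
    (hx : x ∈ Submodule.span KK S) (h0 : ∀ g ∈ S, ℓ g x = 0) : x = 0 := by
  obtain ⟨l, rfl⟩ := (Finsupp.mem_span_iff_linearCombination KK S x).mp hx
  suffices l = 0 by rw [this, map_zero]
  ext g
  have := h0 g g.2
  rw [Finsupp.linearCombination_apply, Finsupp.sum, map_sum, Finset.sum_eq_single g] at this
  · simpa [hℓ g g.2 g g.2] using this
  · intro g' _ hne
    rw [map_smul, hℓ g g.2 g' g'.2, if_neg (fun h => hne (Subtype.ext h.symm)), smul_zero]
  · intro hg
    rw [Finsupp.notMem_support_iff.mp hg, zero_smul, map_zero]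

theorem dual_apply_mem_A0 {S : Set M} {ℓ : M → M →ₗ[KK] KK}
    (hℓ : ∀ g ∈ S, ∀ g' ∈ S, ℓ g g' = if g = g' then 1 else 0) {x : M}
    (hx : x ∈ Submodule.span ↥A0 S) {g : M} (hg : g ∈ S) : ℓ g x ∈ A0 := by
  induction hx using Submodule.span_induction with
  | mem y hy =>
    rw [hℓ g hg y hy]
    split_ifs
    exacts [one_mem _, zero_mem _]
  | zero => rw [map_zero]; exact zero_mem _
  | add y z _ _ hy hz => rw [map_add]; exact add_mem hy hz
  | smul c y _ hy =>
    rw [Subring.smul_def, map_smul]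
    exact mul_mem c.2 hy

theorem dual_apply_mem_range [Module ℚ M] [IsScalarTower ℚ KK M] {S : Set M} {ℓ : M → M →ₗ[KK] KK}
    (hℓ : ∀ g ∈ S, ∀ g' ∈ S, ℓ g g' = if g = g' then 1 else 0) {x : M}
    (hx : x ∈ Submodule.span ℚ S) {g : M} (hg : g ∈ S) : ∃ c : ℚ, ℓ g x = algebraMap ℚ KK c := by
  induction hx using Submodule.span_induction with
  | mem y hy =>
    rw [hℓ g hg y hy]
    split_ifs
    exacts [⟨1, (map_one _).symm⟩, ⟨0, (map_zero _).symm⟩]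
  | zero => exact ⟨0, by rw [map_zero, map_zero]⟩
  | add y z _ _ hy hz =>
    obtain ⟨c, hc⟩ := hy
    obtain ⟨c', hc'⟩ := hz
    exact ⟨c + c', by rw [map_add, map_add, hc, hc']⟩
  | smul r y _ hy =>
    obtain ⟨c, hc⟩ := hy
    exact ⟨r * c, by rw [← algebraMap_smul KK r y, map_smul, hc, smul_eq_mul, map_mul]⟩

end Dual

section GlobalBasis

variable {M : Type} [AddCommGroup M] [Module KK M] [Module G.U M] [IsScalarTower KK G.U M]

variable {G}

theorem mem_qLmod_iff {v x : M} : x ∈ qLmod G v ↔ ∃ y ∈ Llat G v, qv • y = x := Iff.rfl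

theorem qLmod_le_Llat (v : M) : qLmod G v ≤ Llat G v := by
  rintro x ⟨y, hy, rfl⟩
  have hq : qv ∈ A0 := by
    rw [mem_A0_iff, qv, RatFunc.denom_X]
    simp
  exact (Llat G v).smul_mem ⟨qv, hq⟩ hy

/-- An element of `U_A v ∩ L ∩ ψ(L)` lying in `qL` vanishes. -/
theorem IsLowerGlobalBasis.eq_zero_of_mem_qLmod [Module ℚ M] [IsScalarTower ℚ KK M] {v : M}
    {psi : M →+ M} {S : Set M} (h : IsLowerGlobalBasis G v psi S)
    (hspan : Submodule.span KK S = ⊤) {ℓ : M → M →ₗ[KK] KK}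
    (hℓ : ∀ g ∈ S, ∀ g' ∈ S, ℓ g g' = if g = g' then 1 else 0) {x : M}
    (hx : x ∈ UAv G v) (hpsi : psi x = x) (hq : x ∈ qLmod G v) : x = 0 := by
  have hL := qLmod_le_Llat v hq
  have hxQ := h.2.2.2.2.1 x ⟨⟨hx, hL⟩, x, hL, hpsi⟩
  refine eq_zero_of_dual hℓ (hspan ▸ Submodule.mem_top) fun g hg => ?_
  obtain ⟨c, hc⟩ := dual_apply_mem_range hℓ hxQ hg
  obtain ⟨y, hy, rfl⟩ := mem_qLmod_iff.mp hq
  rw [hc]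
  rw [map_smul, smul_eq_mul] at hc
  rw [eq_zero_of_mem_qv_mul_A0 (dual_apply_mem_A0 hℓ (h.1 ▸ hy) hg) hc.symm, map_zero]

end GlobalBasis

section Intertwine

variable {d' : ℕ} {G' : QGroup d'}
variable {M : Type} [AddCommGroup M] [Module KK M] [Module G.U M] [IsScalarTower KK G.U M]
variable {M' : Type} [AddCommGroup M'] [Module KK M'] [Module G'.U M'] [IsScalarTower KK G'.U M']

/-- `p` and `p'` act compatibly with respect to `φ`. -/
def Intertwines {G : QGroup d} [Module G.U M] {G' : QGroup d'} [Module G'.U M'] (φ : M' →ₗ[KK] M)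
    (p : G'.U) (p' : G.U) : Prop := ∀ x, φ (p • x) = p' • φ x

variable {G} {φ : M' →ₗ[KK] M}

theorem Intertwines.one : Intertwines φ (1 : G'.U) (1 : G.U) := fun x => by
  rw [one_smul, one_smul]

theorem Intertwines.zero : Intertwines φ (0 : G'.U) (0 : G.U) := fun x => by
  rw [zero_smul, zero_smul, map_zero]

theorem Intertwines.mul {p q : G'.U} {p' q' : G.U} (h : Intertwines φ p p')
    (h' : Intertwines φ q q') : Intertwines φ (p * q) (p' * q') := fun x => by
  rw [mul_smul, mul_smul, h, h']

theorem Intertwines.add {p q : G'.U} {p' q' : G.U} (h : Intertwines φ p p')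
    (h' : Intertwines φ q q') : Intertwines φ (p + q) (p' + q') := fun x => by
  rw [add_smul, add_smul, map_add, h, h']

theorem Intertwines.sub {p q : G'.U} {p' q' : G.U} (h : Intertwines φ p p')
    (h' : Intertwines φ q q') : Intertwines φ (p - q) (p' - q') := fun x => by
  rw [sub_smul, sub_smul, map_sub, h, h']

theorem Intertwines.neg {p : G'.U} {p' : G.U} (h : Intertwines φ p p') :
    Intertwines φ (-p) (-p') := fun x => by
  rw [neg_smul, neg_smul, map_neg, h]

theorem Intertwines.smul {p : G'.U} {p' : G.U} (h : Intertwines φ p p') (c : KK) :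
    Intertwines φ (c • p) (c • p') := fun x => by
  rw [smul_assoc, smul_assoc, map_smul, h]

theorem Intertwines.pow {p : G'.U} {p' : G.U} (h : Intertwines φ p p') (n : ℕ) :
    Intertwines φ (p ^ n) (p' ^ n) := by
  induction n with
  | zero => rw [pow_zero, pow_zero]; exact .one
  | succ n ih => rw [pow_succ, pow_succ]; exact ih.mul h

theorem Intertwines.list_prod {ι : Type} {p : ι → G'.U} {p' : ι → G.U} {l : List ι}
    (h : ∀ t ∈ l, Intertwines φ (p t) (p' t)) :
    Intertwines φ (l.map p).prod (l.map p').prod := by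
  induction l with
  | nil => exact .one
  | cons t l ih =>
    rw [List.map_cons, List.map_cons, List.prod_cons, List.prod_cons]
    exact (h t List.mem_cons_self).mul (ih fun s hs => h s (List.mem_cons_of_mem t hs))

theorem Intertwines.KmonZ (hd : d' ≤ d)
    (hK : ∀ i, 1 ≤ i → i ≤ d' → Intertwines φ (G'.K i) (G.K i))
    (hKinv : ∀ i, 1 ≤ i → i ≤ d' → Intertwines φ (G'.Kinv i) (G.Kinv i)) (c c' : ℕ → ℤ)
    (hc : ∀ t ≤ d', c' t = c t) (hc' : ∀ t, d' < t → c' t = 0) :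
    Intertwines φ (KmonZ G' c) (KmonZ G c') := by
  obtain ⟨r, rfl⟩ := Nat.exists_eq_add_of_le hd
  rw [QSL.KmonZ, QSL.KmonZ, List.range_add, List.map_append, List.prod_append,
    List.prod_eq_one (l := List.map _ (List.map _ _)), mul_one]
  · refine .list_prod fun t ht => ?_
    have := List.mem_range.mp ht
    rw [hc _ (by omega), zKpow, zKpow]
    split_ifs
    · exact (hK _ (by omega) (by omega)).pow _
    · exact (hKinv _ (by omega) (by omega)).pow _
  · intro y hy
    simp only [List.map_map, List.mem_map, Function.comp_apply] at hy
    obtain ⟨t, -, rfl⟩ := hy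
    rw [hc' _ (by omega)]
    simp [zKpow]

theorem exists_UAring_intertwines (hd : d' ≤ d)
    (he : ∀ i, 1 ≤ i → i ≤ d' → Intertwines φ (G'.e i) (G.e i))
    (hf : ∀ i, 1 ≤ i → i ≤ d' → Intertwines φ (G'.f i) (G.f i))
    (hK : ∀ i, 1 ≤ i → i ≤ d' → Intertwines φ (G'.K i) (G.K i))
    (hKinv : ∀ i, 1 ≤ i → i ≤ d' → Intertwines φ (G'.Kinv i) (G.Kinv i))
    {p : G'.U} (hp : p ∈ UAring G') : ∃ p' ∈ UAring G, Intertwines φ p p' := by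
  induction hp using Subring.closure_induction with
  | mem y hy =>
    obtain (⟨c, hc, rfl⟩ | ⟨i, n, h1, h2, rfl | rfl⟩) | ⟨c, h⟩ := hy
    · refine ⟨algebraMap KK G.U c, Subring.subset_closure (Or.inl (Or.inl ⟨c, hc, rfl⟩)), ?_⟩
      intro x
      rw [algebraMap_smul, algebraMap_smul, map_smul]
    · exact ⟨eDiv G i n, Subring.subset_closure
        (Or.inl (Or.inr ⟨i, n, h1, h2.trans hd, Or.inl rfl⟩)), ((he i h1 h2).pow n).smul _⟩
    · exact ⟨fDiv G i n, Subring.subset_closure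
        (Or.inl (Or.inr ⟨i, n, h1, h2.trans hd, Or.inr rfl⟩)), ((hf i h1 h2).pow n).smul _⟩
    · set c' : ℕ → ℤ := fun t => if t ≤ d' then c t else 0 with hc'
      have hc1 : ∀ t ≤ d', c' t = c t := fun t ht => if_pos ht
      have hc2 : ∀ t, d' < t → c' t = 0 := fun t ht => if_neg ht.not_ge
      have hKm := Intertwines.KmonZ hd hK hKinv c c' hc1 hc2
      have hKm' := Intertwines.KmonZ hd hK hKinv (fun t => -c t) (fun t => -c' t)
        (fun t ht => by rw [hc1 t ht]) (fun t ht => by rw [hc2 t ht, neg_zero])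
      obtain rfl | ⟨n, rfl⟩ := h
      · exact ⟨QSL.KmonZ G c', Subring.subset_closure (Or.inr ⟨c', Or.inl rfl⟩), hKm⟩
      · refine ⟨qhDiv G c' n, Subring.subset_closure (Or.inr ⟨c', Or.inr ⟨n, rfl⟩⟩), ?_⟩
        exact (Intertwines.list_prod fun s _ => ((hKm.smul _).sub (hKm'.smul _)).smul _).smul _
  | zero => exact ⟨0, zero_mem _, .zero⟩
  | one => exact ⟨1, one_mem _, .one⟩
  | add x y _ _ hx hy =>
    obtain ⟨p, hp, h⟩ := hx
    obtain ⟨q, hq, h'⟩ := hy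
    exact ⟨p + q, add_mem hp hq, h.add h'⟩
  | neg x _ hx =>
    obtain ⟨p, hp, h⟩ := hx
    exact ⟨-p, neg_mem hp, h.neg⟩
  | mul x y _ _ hx hy =>
    obtain ⟨p, hp, h⟩ := hx
    obtain ⟨q, hq, h'⟩ := hy
    exact ⟨p * q, mul_mem hp hq, h.mul h'⟩

theorem map_kashSeq [FiniteDimensional KK M] [FiniteDimensional KK M'] (hd : d' ≤ d)
    (he : ∀ i, 1 ≤ i → i ≤ d' → Intertwines φ (G'.e i) (G.e i))
    (hf : ∀ i, 1 ≤ i → i ≤ d' → Intertwines φ (G'.f i) (G.f i))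
    (hK : ∀ i, 1 ≤ i → i ≤ d' → Intertwines φ (G'.K i) (G.K i)) {μ ν : ℕ → ℤ} {u : M'}
    (hu : IsWtVec G' u μ) (hφu : IsWtVec G (φ u) ν) {is : List ℕ}
    (his : ∀ i ∈ is, 1 ≤ i ∧ i ≤ d') : φ (kashSeq G' is u) = kashSeq G is (φ u) := by
  induction is using List.reverseRecOn with
  | nil => rfl
  | append_singleton is i ih =>
    have hi := his i (by simp)
    have his' : ∀ j ∈ is, 1 ≤ j ∧ j ≤ d' := fun j hj => his j (by simp [hj])
    have hwt := isWtVec_kashSeq hφu is fun j hj => ⟨(his' j hj).1, (his' j hj).2.trans hd⟩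
    rw [← ih his'] at hwt
    rw [kashSeq_concat, kashSeq_concat, ← ih his']
    exact map_kashF hi.1 (hi.2.trans hd) hi.2 (he i hi.1 hi.2) (hf i hi.1 hi.2) (hK i hi.1 hi.2)
      (isWtVec_kashSeq hu is his') hwt

theorem map_word (hf : ∀ i, 1 ≤ i → i ≤ d' → Intertwines φ (G'.f i) (G.f i)) {u : M'}
    {is : List ℕ} (his : ∀ i ∈ is, 1 ≤ i ∧ i ≤ d') : φ (word G' is u) = word G is (φ u) := by
  induction is with
  | nil => rfl
  | cons i is ih =>
    have hi := his i List.mem_cons_self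
    rw [word_cons, word_cons, hf i hi.1 hi.2,
      ih fun j hj => his j (List.mem_cons_of_mem i hj)]

theorem map_mem_Llat {u : M'} {v : M}
    (h : ∀ x ∈ latticeGens G' u, φ x ∈ latticeGens G v) {x : M'} (hx : x ∈ Llat G' u) :
    φ x ∈ Llat G v := by
  have : Llat G' u ≤ (Llat G v).comap (toA0Linear φ) :=
    Submodule.span_le.mpr fun y hy => Submodule.subset_span (h y hy)
  exact this hx

theorem map_mem_qLmod {u : M'} {v : M}
    (h : ∀ x ∈ latticeGens G' u, φ x ∈ latticeGens G v) {x : M'} (hx : x ∈ qLmod G' u) :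
    φ x ∈ qLmod G v := by
  obtain ⟨y, hy, rfl⟩ := hx
  exact ⟨φ y, map_mem_Llat h hy, (map_smul φ qv y).symm⟩

theorem psi_map {barK : KK →+* KK} {lam : ℕ → ℤ} {u : M'} {v : M} {psi : M →+ M}
    {psi' : M' →+ M'} (hu : IsHWModule G' lam u) (hpsi : IsPsi G v barK psi)
    (hpsi' : IsPsi G' u barK psi') (hd : d' ≤ d)
    (hf : ∀ i, 1 ≤ i → i ≤ d' → Intertwines φ (G'.f i) (G.f i)) (hfix : psi (φ u) = φ u) (x : M') :
    psi (φ x) = φ (psi' x) := by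
  have hx : x ∈ Submodule.span KK _ := hu.span_words ▸ Submodule.mem_top
  induction hx using Submodule.span_induction with
  | mem y hy =>
    obtain ⟨is, his, rfl⟩ := hy
    rw [hpsi'.map_word his, hpsi'.1, map_word hf his,
      hpsi.map_word (fun i hi => ⟨(his i hi).1, (his i hi).2.trans hd⟩), hfix]
  | zero => simp only [map_zero]
  | add y z _ _ hy hz => simp only [map_add, hy, hz]
  | smul c y _ hy => rw [map_smul, hpsi.2.1, hpsi'.2.1, map_smul, hy]

end Intertwine

section Restriction

variable {G}

theorem sum_cartan_pos (a r : ℕ) :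
    0 < ∑ s ∈ Finset.range (r + 1), cartan (a + r) (a + s) := by
  rw [Finset.sum_range_succ, cartan, if_pos rfl]
  cases r with
  | zero => simp
  | succ r =>
    rw [Finset.sum_range_succ, Finset.sum_eq_zero, cartan, if_neg (by omega), if_pos (by omega)]
    · norm_num
    · intro s hs
      have := Finset.mem_range.mp hs
      rw [cartan, if_neg (by omega), if_neg (by omega)]

theorem chainWt_injective (lam : ℕ → ℤ) (a r : ℕ) {j j' : ℕ}
    (h : chainWt lam a j (r + 1) (a + r) = chainWt lam a j' (r + 1) (a + r)) : j = j' := by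
  rw [chainWt, chainWt, ← Finset.mul_sum, ← Finset.mul_sum, sub_right_inj] at h
  exact_mod_cast mul_right_cancel₀ (sum_cartan_pos a r).ne' h

variable {M : Type} [AddCommGroup M] [Module KK M] [Module G.U M] [IsScalarTower KK G.U M]

theorem apply_fDivChain_eq_zero {B : M →ₗ[KK] M →ₗ[KK] KK} {v : M} (hB : IsShapovalov G v B)
    {lam : ℕ → ℤ} (hv : IsWtVec G v lam) {a : ℕ} (ha : 1 ≤ a) (had : a ≤ d) {j j' : ℕ}
    (hj : j ≠ j') :
    B (fDivChain G (fun _ => j) a d v) (fDivChain G (fun _ => j') a d v) = 0 := by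
  obtain ⟨r, rfl⟩ := Nat.exists_eq_add_of_le had
  have hr : a + r + 1 - a = r + 1 := by omega
  rw [fDivChain_const, fDivChain_const, hr]
  have hwt : ∀ n, G.K (a + r) • chainVec G a n v (r + 1) =
      qv ^ chainWt lam a n (r + 1) (a + r) • chainVec G a n v (r + 1) := fun n =>
    isWtVec_chainVec hv ha n (by omega) (a + r) (by omega) le_rfl
  exact hB.apply_eq_zero_of_ne (by omega) le_rfl (fun h => hj (chainWt_injective lam a r h))
    (hwt j) (hwt j')

variable {d' : ℕ} {G' : QGroup d'}

/-- Pulling back a contravariant form along two module maps which send the highest weight vectors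
to orthogonal vectors yields zero. -/
theorem apply_map_map_eq_zero {B : M →ₗ[KK] M →ₗ[KK] KK} {v : M} (hB : IsShapovalov G v B)
    (hd : d' ≤ d)
    {M₁ : Type} [AddCommGroup M₁] [Module KK M₁] [Module G'.U M₁] [IsScalarTower KK G'.U M₁]
    {M₂ : Type} [AddCommGroup M₂] [Module KK M₂] [Module G'.U M₂] [IsScalarTower KK G'.U M₂]
    {φ₁ : M₁ →ₗ[KK] M} {φ₂ : M₂ →ₗ[KK] M} {u₁ : M₁} {u₂ : M₂} {lam₁ lam₂ : ℕ → ℤ}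
    (h₁ : IsHWModule G' lam₁ u₁) (h₂ : IsHWModule G' lam₂ u₂)
    (he₁ : ∀ i, 1 ≤ i → i ≤ d' → Intertwines φ₁ (G'.e i) (G.e i))
    (hf₁ : ∀ i, 1 ≤ i → i ≤ d' → Intertwines φ₁ (G'.f i) (G.f i))
    (he₂ : ∀ i, 1 ≤ i → i ≤ d' → Intertwines φ₂ (G'.e i) (G.e i))
    (hf₂ : ∀ i, 1 ≤ i → i ≤ d' → Intertwines φ₂ (G'.f i) (G.f i))
    (h0 : B (φ₁ u₁) (φ₂ u₂) = 0) (x : M₁) (y : M₂) : B (φ₁ x) (φ₂ y) = 0 := by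
  have h : B.compl₁₂ φ₁ φ₂ = 0 := by
    refine form_eq_zero h₁ h₂ (fun i h1 h2 x y => ?_) (fun i h1 h2 x y => ?_) h0
    · rw [LinearMap.compl₁₂_apply, LinearMap.compl₁₂_apply, he₁ i h1 h2, hf₂ i h1 h2,
        hB.2.2.1 i h1 (h2.trans hd)]
    · rw [LinearMap.compl₁₂_apply, LinearMap.compl₁₂_apply, hf₁ i h1 h2, he₂ i h1 h2,
        hB.2.2.2.1 i h1 (h2.trans hd)]
  exact LinearMap.congr_fun₂ h x y

variable {M' : Type} [AddCommGroup M'] [Module KK M'] [Module G'.U M'] [IsScalarTower KK G'.U M']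
variable {φ : M' →ₗ[KK] M}

/-- A module map from a highest weight module is an isometry up to a scalar. -/
theorem apply_map_map {B : M →ₗ[KK] M →ₗ[KK] KK} {v : M} (hB : IsShapovalov G v B)
    (hd : d' ≤ d) {B' : M' →ₗ[KK] M' →ₗ[KK] KK} {u : M'} (hB' : IsShapovalov G' u B')
    {lam : ℕ → ℤ} (h : IsHWModule G' lam u)
    (he : ∀ i, 1 ≤ i → i ≤ d' → Intertwines φ (G'.e i) (G.e i))
    (hf : ∀ i, 1 ≤ i → i ≤ d' → Intertwines φ (G'.f i) (G.f i)) (x y : M') :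
    B (φ x) (φ y) = B (φ u) (φ u) * B' x y := by
  have h : B.compl₁₂ φ φ - B (φ u) (φ u) • B' = 0 := by
    refine form_eq_zero h h (fun i h1 h2 x y => ?_) (fun i h1 h2 x y => ?_) ?_ <;>
      simp only [LinearMap.sub_apply, LinearMap.smul_apply, LinearMap.compl₁₂_apply]
    · rw [he i h1 h2, hf i h1 h2, hB.2.2.1 i h1 (h2.trans hd), hB'.2.2.1 i h1 h2]
    · rw [he i h1 h2, hf i h1 h2, hB.2.2.2.1 i h1 (h2.trans hd), hB'.2.2.2.1 i h1 h2]
    · rw [hB'.2.1, smul_eq_mul, mul_one, sub_self]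
  exact sub_eq_zero.mp (LinearMap.congr_fun₂ h x y)

/-- A module map sending the highest weight vector into the crystal maps the crystal to the
crystal. -/
theorem map_mem_latticeGens [FiniteDimensional KK M] [FiniteDimensional KK M'] (hd : d' ≤ d)
    (he : ∀ i, 1 ≤ i → i ≤ d' → Intertwines φ (G'.e i) (G.e i))
    (hf : ∀ i, 1 ≤ i → i ≤ d' → Intertwines φ (G'.f i) (G.f i))
    (hK : ∀ i, 1 ≤ i → i ≤ d' → Intertwines φ (G'.K i) (G.K i)) {μ ν : ℕ → ℤ} {u : M'} {v : M}
    (hu : IsWtVec G' u μ) (hv : IsWtVec G v ν) (hφu : φ u ∈ latticeGens G v) {x : M'}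
    (hx : x ∈ latticeGens G' u) : φ x ∈ latticeGens G v := by
  obtain ⟨is, his, rfl⟩ := hx
  obtain ⟨is₀, his₀, h₀⟩ := hφu
  have hwt := h₀ ▸ isWtVec_kashSeq hv is₀ his₀
  refine ⟨is₀ ++ is, fun i hi => ?_, ?_⟩
  · rcases List.mem_append.mp hi with hi | hi
    · exact his₀ i hi
    · exact ⟨(his i hi).1, (his i hi).2.trans hd⟩
  · rw [map_kashSeq hd he hf hK hu hwt his, kashSeq_append, h₀]

variable [Module ℚ M] [IsScalarTower ℚ KK M] [Module ℚ M'] [IsScalarTower ℚ KK M']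

/-- An injective module map sending the highest weight vector to a `ψ`-invariant element of the
crystal and of `U_A v` maps the lower global basis into the lower global basis. -/
theorem IsLowerGlobalBasis.map_mem (hd : d' ≤ d)
    (he : ∀ i, 1 ≤ i → i ≤ d' → Intertwines φ (G'.e i) (G.e i))
    (hf : ∀ i, 1 ≤ i → i ≤ d' → Intertwines φ (G'.f i) (G.f i))
    (hK : ∀ i, 1 ≤ i → i ≤ d' → Intertwines φ (G'.K i) (G.K i))
    (hKinv : ∀ i, 1 ≤ i → i ≤ d' → Intertwines φ (G'.Kinv i) (G.Kinv i))
    (hφ : Function.Injective φ) {barK : KK →+* KK} {lam lam' : ℕ → ℤ} {v : M} {u : M'}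
    (hv : IsHWModule G lam v) (hu : IsHWModule G' lam' u) {psi : M →+ M} {psi' : M' →+ M'}
    (hpsi : IsPsi G v barK psi) (hpsi' : IsPsi G' u barK psi') {S : Set M} {S' : Set M'}
    (hS : IsLowerGlobalBasis G v psi S) (hS' : IsLowerGlobalBasis G' u psi' S')
    {ℓ : M → M →ₗ[KK] KK} (hℓ : ∀ g ∈ S, ∀ g' ∈ S, ℓ g g' = if g = g' then 1 else 0)
    (hφu : φ u ∈ latticeGens G v) (hφu' : φ u ∈ UAv G v) (hfix : psi (φ u) = φ u)
    {g : M'} (hg : g ∈ S') (hg0 : g ≠ 0) : φ g ∈ S := by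
  have := hv.findim
  have := hu.findim
  have hspan : Submodule.span KK S = ⊤ := span_eq_top_of_span_A0 hv.span_latticeGens hS.1
  have hgens : ∀ x ∈ latticeGens G' u, φ x ∈ latticeGens G v := fun x hx =>
    map_mem_latticeGens hd he hf hK hu.wt hv.wt hφu hx
  have hUA : φ g ∈ UAv G v := by
    obtain ⟨p, hp, hpg⟩ := (hS'.2.2.1 hg).1.1
    obtain ⟨q, hq, hqu⟩ := hφu'
    obtain ⟨p', hp', h⟩ := exists_UAring_intertwines hd he hf hK hKinv hp
    exact ⟨p' * q, mul_mem hp' hq, by rw [hpg, h, hqu, mul_smul]⟩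
  have hpg : psi (φ g) = φ g := by
    rw [psi_map hu hpsi hpsi' hd hf hfix, hS'.2.2.2.2.2.1 g hg]
  obtain ⟨u', hu', -, hgu⟩ := hS'.2.2.2.2.2.2.1 g hg
  have hφgu := map_mem_qLmod hgens hgu
  rw [map_sub] at hφgu
  by_cases hq : φ u' ∈ qLmod G v
  · refine absurd (hφ ?_) hg0
    rw [map_zero]
    refine hS.eq_zero_of_mem_qLmod hspan hℓ hUA hpg ?_
    simpa using add_mem hφgu hq
  · obtain ⟨g', hg', hgu'⟩ := hS.2.2.2.2.2.2.2.2 _ (hgens u' hu') hq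
    obtain ⟨p, hp, hpv⟩ := hUA
    obtain ⟨p', hp', hpv'⟩ := (hS.2.2.1 hg').1.1
    have : φ g - g' = 0 := by
      refine hS.eq_zero_of_mem_qLmod hspan hℓ ⟨p - p', sub_mem hp hp', ?_⟩ ?_ ?_
      · rw [hpv, hpv', sub_smul]
      · rw [map_sub, hpg, hS.2.2.2.2.2.1 g' hg']
      · simpa using sub_mem hφgu hgu'
    rwa [sub_eq_zero.mp this]

end Restriction

section DualBasis

variable {M : Type} [AddCommGroup M] [Module KK M] {ι : Type} {N : ι → Type}
  [∀ j, AddCommGroup (N j)] [∀ j, Module KK (N j)]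

/-- Dual bases with respect to a form which is an orthogonal sum of rescaled forms. -/
theorem dual_basis_of_orthogonal_sum {B : M →ₗ[KK] M →ₗ[KK] KK} {S : Set M} {F : M → M}
    (hF : ∀ g ∈ S, ∀ g' ∈ S, B (F g) g' = if g = g' then 1 else 0)
    {C : (j : ι) → N j →ₗ[KK] N j →ₗ[KK] KK} {T : (j : ι) → Set (N j)} {E : (j : ι) → N j → N j}
    (hE : ∀ j, ∀ g ∈ T j, ∀ g' ∈ T j, C j (E j g) g' = if g = g' then 1 else 0)
    {φ : (j : ι) → N j →ₗ[KK] M} (hφ : ∀ j, Function.Injective (φ j))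
    (hmem : ∀ j, ∀ g ∈ T j, φ j g ∈ S) {c : ι → KK} (hc : ∀ j, c j ≠ 0)
    (hB : ∀ j x y, B (φ j x) (φ j y) = c j * C j x y)
    (hB0 : ∀ j j', j ≠ j' → ∀ x y, B (φ j x) (φ j' y) = 0)
    (hnd : ∀ x, (∀ j, ∀ g ∈ T j, B x (φ j g) = 0) → x = 0) :
    (∀ j, ∀ g ∈ T j, φ j (E j g) = c j • F (φ j g)) ∧
    (F '' S = ⋃ j, (fun x => (c j)⁻¹ • φ j x) '' (E j '' T j)) ∧
    (∀ j j', j ≠ j' → Disjoint ((fun x => (c j)⁻¹ • φ j x) '' (E j '' T j))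
      ((fun x => (c j')⁻¹ • φ j' x) '' (E j' '' T j'))) := by
  have hne : ∀ j j', j ≠ j' → ∀ g ∈ T j, ∀ g' ∈ T j', φ j g ≠ φ j' g' := by
    intro j j' hj g hg g' hg' h
    have h1 := hB j (E j g) g
    rw [hE j g hg g hg, if_pos rfl, mul_one, h, hB0 j j' hj] at h1
    exact hc j h1.symm
  have key : ∀ j, ∀ g ∈ T j, φ j (E j g) = c j • F (φ j g) := by
    intro j g hg
    refine sub_eq_zero.mp (hnd _ fun j' g' hg' => ?_)
    rw [map_sub, LinearMap.sub_apply, map_smul, LinearMap.smul_apply, smul_eq_mul,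
      hF _ (hmem j g hg) _ (hmem j' g' hg')]
    obtain rfl | hj := eq_or_ne j j'
    · simp only [hB, hE j g hg g' hg', (hφ j).eq_iff, sub_self]
    · rw [hB0 j j' hj, if_neg (hne j j' hj g hg g' hg'), mul_zero, sub_zero]
  have key' : ∀ j, ∀ g ∈ T j, (c j)⁻¹ • φ j (E j g) = F (φ j g) := by
    intro j g hg
    rw [key j g hg, inv_smul_smul₀ (hc j)]
  refine ⟨key, ?_, ?_⟩
  · ext x
    simp only [Set.mem_iUnion, Set.mem_image, exists_exists_and_eq_and]
    constructor
    · rintro ⟨g, hg, rfl⟩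
      by_contra! hcon
      have h0 : F g = 0 := hnd _ fun j g' hg' => by
        rw [hF g hg _ (hmem j g' hg'), if_neg]
        rintro rfl
        exact hcon j g' hg' (key' j g' hg')
      have h1 := hF g hg g hg
      rw [h0, if_pos rfl, map_zero, LinearMap.zero_apply] at h1
      exact zero_ne_one h1
    · rintro ⟨j, g, hg, rfl⟩
      exact ⟨φ j g, hmem j g hg, (key' j g hg).symm⟩
  · intro j j' hj
    rw [Set.disjoint_left]
    rintro _ ⟨_, ⟨g, hg, rfl⟩, rfl⟩ ⟨_, ⟨g', hg', rfl⟩, h⟩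
    simp only [key' j g hg, key' j' g' hg'] at h
    have h1 := hF _ (hmem j g hg) _ (hmem j g hg)
    rw [← h, hF _ (hmem j' g' hg') _ (hmem j g hg), if_neg (hne j j' hj g hg g' hg').symm,
      if_pos rfl] at h1
    exact zero_ne_one h1

end DualBasis

/-- Theorem `upper`:  for `λ = m ω_a`, the upper global
basis (the dual basis `F^λ = {F_b}` of the lower global basis with respect to
the Shapovalov form) satisfies `F^λ = ⊔_{j=0}^m φ_j(F̂^{λ^j})/(v_j, v_j)`;
in particular `φ_j(F̂^j_b)/(v_j, v_j) = F_{φ_j(b)}` for all `b ∈ B̂^{λ^j}`. -/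
theorem upper_global_basis_restriction
    (k a m : ℕ) (hk : 3 ≤ k) (ha : 1 ≤ a) (hak : a ≤ k - 1) (hm : 1 ≤ m)
    (G : QGroup (k - 1)) (V : Type) [AddCommGroup V] [Module ℚ V] [Module KK V]
    [Module G.U V] [IsScalarTower KK G.U V] [IsScalarTower ℚ KK V]
    (v : V) (hV : IsHWModule G (omWt a m) v)
    (barK : KK →+* KK) (hbar : IsBarK barK)
    (psi : V →+ V) (hpsi : IsPsi G v barK psi)
    (Gs : Set V) (hGs : IsLowerGlobalBasis G v psi Gs)
    (H : QGroup (k - 2))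
    (Vhat : Fin (m + 1) → Type) [∀ j, AddCommGroup (Vhat j)]
    [∀ j, Module ℚ (Vhat j)] [∀ j, Module KK (Vhat j)] [∀ j, Module H.U (Vhat j)]
    [∀ j, IsScalarTower KK H.U (Vhat j)] [∀ j, IsScalarTower ℚ KK (Vhat j)]
    (u : (j : Fin (m + 1)) → Vhat j)
    (hu : ∀ j : Fin (m + 1), IsHWModule H (hookWt a m j.1) (u j))
    (psihat : (j : Fin (m + 1)) → (Vhat j →+ Vhat j))
    (hpsihat : ∀ j, IsPsi H (u j) barK (psihat j))
    (Ghat : (j : Fin (m + 1)) → Set (Vhat j))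
    (hGhat : ∀ j, IsLowerGlobalBasis H (u j) (psihat j) (Ghat j))
    (φ : (j : Fin (m + 1)) → (Vhat j →ₗ[KK] V))
    (hφu : ∀ j : Fin (m + 1), φ j (u j) = fDivChain G (fun _ => j.1) a (k - 1) v)
    (hφe : ∀ (j : Fin (m + 1)) i, 1 ≤ i → i ≤ k - 2 → ∀ x : Vhat j,
        φ j (H.e i • x) = G.e i • φ j x)
    (hφf : ∀ (j : Fin (m + 1)) i, 1 ≤ i → i ≤ k - 2 → ∀ x : Vhat j,
        φ j (H.f i • x) = G.f i • φ j x)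
    (hφK : ∀ (j : Fin (m + 1)) i, 1 ≤ i → i ≤ k - 2 → ∀ x : Vhat j,
        φ j (H.K i • x) = G.K i • φ j x)
    (hφKinv : ∀ (j : Fin (m + 1)) i, 1 ≤ i → i ≤ k - 2 → ∀ x : Vhat j,
        φ j (H.Kinv i • x) = G.Kinv i • φ j x)
    (hφinj : ∀ j : Fin (m + 1), Function.Injective (φ j))
    (hφrange : ∀ j : Fin (m + 1), LinearMap.range (φ j) =
        USpan G (k - 2) (fDivChain G (fun _ => j.1) a (k - 1) v))
    (Bf : V →ₗ[KK] V →ₗ[KK] KK) (hBf : IsShapovalov G v Bf)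
    (Fmap : V → V)
    (hFmap : ∀ g ∈ Gs, ∀ g' ∈ Gs, Bf (Fmap g) g' = if g = g' then 1 else 0)
    (Bhat : (j : Fin (m + 1)) → (Vhat j →ₗ[KK] Vhat j →ₗ[KK] KK))
    (hBhat : ∀ j, IsShapovalov H (u j) (Bhat j))
    (Fmaphat : (j : Fin (m + 1)) → Vhat j → Vhat j)
    (hFmaphat : ∀ j, ∀ g ∈ Ghat j, ∀ g' ∈ Ghat j,
        Bhat j (Fmaphat j g) g' = if g = g' then 1 else 0) :
    -- in particular:  `φ_j(F̂^j_b) = (v_j, v_j) • F_{φ_j(b)}`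
    (∀ j : Fin (m + 1), ∀ g ∈ Ghat j,
        φ j (Fmaphat j g) =
          (Bf (fDivChain G (fun _ => j.1) a (k - 1) v)
              (fDivChain G (fun _ => j.1) a (k - 1) v)) • Fmap (φ j g)) ∧
    -- `F^λ = ⊔_{j=0}^m φ_j(F̂^{λ^j})/(v_j, v_j)`
    (Fmap '' Gs = ⋃ j : Fin (m + 1),
        (fun x => (Bf (fDivChain G (fun _ => j.1) a (k - 1) v)
            (fDivChain G (fun _ => j.1) a (k - 1) v))⁻¹ • φ j x) ''
          (Fmaphat j '' Ghat j)) ∧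
    (∀ j j' : Fin (m + 1), j ≠ j' →
      Disjoint
        ((fun x => (Bf (fDivChain G (fun _ => j.1) a (k - 1) v)
            (fDivChain G (fun _ => j.1) a (k - 1) v))⁻¹ • φ j x) ''
          (Fmaphat j '' Ghat j))
        ((fun x => (Bf (fDivChain G (fun _ => j'.1) a (k - 1) v)
            (fDivChain G (fun _ => j'.1) a (k - 1) v))⁻¹ • φ j' x) ''
          (Fmaphat j' '' Ghat j'))) := by
  have hd : k - 2 ≤ k - 1 := by omega
  have hlen : a + (k - 1 + 1 - a) ≤ k - 1 + 1 := by omega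
  have := hV.findim
  have hiso := fun j => apply_map_map hBf hd (hBhat j) (hu j) (hφe j) (hφf j)
  have horth : ∀ j j', j ≠ j' → ∀ x y, Bf (φ j x) (φ j' y) = 0 := fun j j' hj =>
    apply_map_map_eq_zero hBf hd (hu j) (hu j') (hφe j) (hφf j) (hφe j') (hφf j') <| by
      rw [hφu, hφu]
      exact apply_fDivChain_eq_zero hBf hV.wt ha hak (Fin.val_ne_of_ne hj)
  have hnd : ∀ x, (∀ j y, Bf x (φ j y) = 0) → x = 0 := by
    let P : Submodule KK V := ⨅ j, LinearMap.ker ((LinearMap.lcomp KK KK (φ j)).comp Bf)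
    have hmem : ∀ x, x ∈ P ↔ ∀ j y, Bf x (φ j y) = 0 := fun x => by
      simp [P, LinearMap.ext_iff]
    have hP : P = ⊥ := by
      refine eq_bot_of_apply_chainVec_eq_zero ha hak hBf hV (fun i h1 h2 x hx => ?_)
        fun j hj x hx => ?_
      · rw [hmem] at hx ⊢
        intro j y
        rw [hBf.2.2.1 i h1 (by omega), ← hφf j i h1 (by omega)]
        exact hx j _
      · rw [← hφu ⟨j, Nat.lt_succ_of_le hj⟩]
        exact (hmem x).mp hx _ _
    intro x hx
    rwa [← hmem, hP, Submodule.mem_bot] at hx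
  have hspan : ∀ j, Submodule.span KK (Ghat j) = ⊤ := fun j =>
    span_eq_top_of_span_A0 (hu j).span_latticeGens (hGhat j).1
  have hmap : ∀ j, ∀ g ∈ Ghat j, φ j g ∈ Gs := by
    intro j g hg
    refine IsLowerGlobalBasis.map_mem hd (hφe j) (hφf j) (hφK j) (hφKinv j) (hφinj j) hV (hu j)
      hpsi (hpsihat j) hGs (hGhat j) (ℓ := fun g => Bf (Fmap g)) hFmap ?_ ?_ ?_ hg ?_
    · rw [hφu, fDivChain_const]
      exact chainVec_mem_latticeGens hV.wt hV.hw ha j.1 hlen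
    · rw [hφu, fDivChain_const]
      exact exists_UAring_smul_eq_chainVec v ha j.1 hlen
    · rw [hφu, fDivChain_const]
      exact hpsi.map_chainVec hbar ha j.1 hlen
    · rintro rfl
      simpa using hFmaphat j 0 hg 0 hg
  refine dual_basis_of_orthogonal_sum hFmap hFmaphat hφinj hmap (fun j hj => ?_)
    (fun j x y => by rw [hiso j x y, hφu]) horth fun x hx => hnd x fun j y => ?_
  · refine (hu j).ne_zero (hφinj j ?_)
    rw [map_zero]
    refine hnd _ fun j' y => ?_
    obtain rfl | hne := eq_or_ne j j'
    · rw [hiso j, hφu, hj, zero_mul]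
    · exact horth j j' hne _ _
  · have : (Bf x).comp (φ j) = 0 := LinearMap.ext_on (hspan j) fun g hg => hx j g hg
    exact LinearMap.congr_fun this y

end QSL
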